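/- arXiv:1102.4834 — 3 statements merged into one kernel-verified Lean document; each statement's English description precedes it below -/
import Mathlib

section
/- Let A>1 and m>2 be integers, let a₀ > 1 and j ≥ 1 be the (unique) integers with a₀^j = A and a₀ not a perfect power, and set d = (A^(m−1) − 1)/(A − 1) and h = gcd(d·A − 1, A − 1). Then, with a = a₀, b = d·A, c = A·(d−1)/h, r = (d·A − 1)/h, s = (A − 1)/h (all of which are positive integers), the three pairs (x,y) = (0,0), (j,1), and (m·j, 2) are three distinct solutions in nonnegative integers of the equation r·a^x − s·b^y = c. -/
/-- An integer `N > 1` is a perfect power if `N = t^k` with `t > 1` and `k > 1`. -/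
def IsPerfectPower (N : ℤ) : Prop :=
  ∃ (t : ℤ) (k : ℕ), 1 < t ∧ 1 < k ∧ t ^ k = N

theorem stmt_11 (A : ℤ) (m : ℕ) (a₀ : ℤ) (j : ℕ)
    (hA : 1 < A) (hm : 2 < m)
    (ha₀ : 1 < a₀) (hj : 1 ≤ j) (hA' : a₀ ^ j = A)
    (hnp : ¬IsPerfectPower a₀) :
    -- with d = (A^(m-1) - 1)/(A - 1) and h = gcd(d*A - 1, A - 1),
    -- set a = a₀, b = d*A, c = A*(d-1)/h, r = (d*A - 1)/h, s = (A - 1)/h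
    let d : ℤ := (A ^ (m - 1) - 1) / (A - 1)
    let h : ℤ := Int.gcd (d * A - 1) (A - 1)
    let bb : ℤ := d * A
    let cc : ℤ := A * (d - 1) / h
    let rr : ℤ := (d * A - 1) / h
    let ss : ℤ := (A - 1) / h
    -- all the relevant quantities are positive integers (the divisions are exact)
    1 < bb ∧ 0 < cc ∧ 0 < rr ∧ 0 < ss ∧
      h ∣ A * (d - 1) ∧ h ∣ d * A - 1 ∧ h ∣ A - 1 ∧
      -- the three pairs are pairwise distinct
      ((0 : ℕ), (0 : ℕ)) ≠ ((j : ℕ), (1 : ℕ)) ∧ ((0 : ℕ), (0 : ℕ)) ≠ (m * j, (2 : ℕ)) ∧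
      ((j : ℕ), (1 : ℕ)) ≠ (m * j, (2 : ℕ)) ∧
      -- and each is a solution of r·a^x − s·b^y = c
      rr * a₀ ^ (0 : ℕ) - ss * bb ^ (0 : ℕ) = cc ∧
      rr * a₀ ^ j - ss * bb ^ (1 : ℕ) = cc ∧
      rr * a₀ ^ (m * j) - ss * bb ^ (2 : ℕ) = cc := by
  intro d h bb cc rr ss
  have hA1 : 0 < A - 1 := by linarith
  have hd : A ^ (m - 1) - 1 = (A - 1) * d :=
    (Int.mul_ediv_cancel' (by simpa using sub_dvd_pow_sub_pow A 1 (m - 1))).symm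
  have hAm : A ^ m = A * ((A - 1) * d + 1) := by
    rw [← hd, sub_add_cancel, ← pow_succ']
    congr 1
    omega
  have hd1 : 1 < d := by
    have hle : A ^ 2 ≤ A ^ (m - 1) := pow_le_pow_right₀ hA.le (by omega)
    nlinarith
  have hr_pos : 0 < d * A - 1 := by nlinarith
  have hr : h ∣ d * A - 1 := Int.gcd_dvd_left ..
  have hs : h ∣ A - 1 := Int.gcd_dvd_right ..
  have hc : h ∣ A * (d - 1) := by
    have := dvd_sub hr hs
    rwa [show d * A - 1 - (A - 1) = A * (d - 1) by ring] at this
  have hh : 0 < h := Int.natCast_pos.mpr (Int.gcd_pos_of_ne_zero_right _ hA1.ne')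
  have er : h * rr = d * A - 1 := Int.mul_ediv_cancel' hr
  have es : h * ss = A - 1 := Int.mul_ediv_cancel' hs
  have ec : h * cc = A * (d - 1) := Int.mul_ediv_cancel' hc
  have hbb : bb = d * A := rfl
  have hc_pos : 0 < A * (d - 1) := mul_pos (by linarith) (by linarith)
  refine ⟨by linarith, pos_of_mul_pos_right (ec ▸ hc_pos) hh.le,
    pos_of_mul_pos_right (er ▸ hr_pos) hh.le, pos_of_mul_pos_right (es ▸ hA1) hh.le,
    hc, hr, hs, by simp, by simp, by simp, ?_, ?_, ?_⟩ <;>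
    apply mul_left_cancel₀ hh.ne'
  · linear_combination er - es - ec
  · rw [hA', hbb]
    linear_combination A * er - d * A * es - ec
  · rw [mul_comm m j, pow_mul, hA', hAm, hbb]
    linear_combination A * ((A - 1) * d + 1) * er - (d * A) ^ 2 * es - ec
end

section
/- Let A>1 and m>2 be integers and set d = (A^(m−1) − 1)/(A − 1) (an integer). Then d·A is not a perfect power, i.e., there are no integers y>1 and q≥2 with d·A = y^q. -/
open Finset Polynomial

theorem choose_mul_factorial_eq_prod (x : ℝ) (n : ℕ) :
    Ring.choose x n * (n.factorial : ℝ) = ∏ m ∈ range n, (x - m) := by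
  induction n with
  | zero => simp
  | succ n ih =>
    have h1 := Ring.descPochhammer_eq_factorial_smul_choose x (n + 1)
    have h0 := Ring.descPochhammer_eq_factorial_smul_choose x n
    rw [descPochhammer_succ_right, Polynomial.smeval_mul, h0] at h1
    rw [prod_range_succ, ← ih]
    simp [Polynomial.smeval_sub, Polynomial.smeval_natCast] at h1
    linear_combination -h1

theorem sum_neg_one_pow_mul_choose_div (k : ℕ) (x : ℝ) (hx : ∀ l ∈ range (k + 1), x + l ≠ 0) :
    ∑ l ∈ range (k + 1), (-1) ^ l * (k.choose l : ℝ) / (x + l) =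
      k.factorial / ∏ l ∈ range (k + 1), (x + l) := by
  induction k generalizing x with
  | zero => simp
  | succ k ih =>
    have h0 := ih x fun l hl => hx l (by simp at hl ⊢; omega)
    have h1 := ih (x + 1) fun l hl => by
      have := hx (l + 1) (by simp at hl ⊢; omega)
      push_cast at this
      rwa [add_assoc, add_comm 1 (l : ℝ)]
    have hs : ∑ l ∈ range (k + 1 + 1), (-1) ^ l * ((k + 1).choose l : ℝ) / (x + l) =
        ∑ l ∈ range (k + 1), (-1) ^ l * (k.choose l : ℝ) / (x + l) -
        ∑ l ∈ range (k + 1), (-1) ^ l * (k.choose l : ℝ) / (x + 1 + l) := by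
      have h2 : ∑ l ∈ range (k + 1), (-1) ^ l * (k.choose l : ℝ) / (x + l) =
          ∑ l ∈ range (k + 1), (-1) ^ (l + 1) * (k.choose (l + 1) : ℝ) / (x + (l + 1 : ℕ)) +
            1 / x := by
        have := sum_range_succ' (fun l : ℕ => (-1) ^ l * (k.choose l : ℝ) / (x + l)) (k + 1)
        rw [sum_range_succ] at this
        simpa using this
      rw [sum_range_succ', h2, add_sub_right_comm, ← sum_sub_distrib]
      congr 1
      · refine sum_congr rfl fun l _ => ?_
        rw [Nat.choose_succ_succ]
        push_cast
        rw [add_assoc, add_comm 1 (l : ℝ)]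
        ring
      · simp
    rw [hs, h0, h1]
    have hA : ∏ l ∈ range (k + 1), (x + l) ≠ 0 :=
      prod_ne_zero_iff.2 fun l hl => hx l (by simp at hl ⊢; omega)
    have hA' : ∏ l ∈ range (k + 1 + 1), (x + l) ≠ 0 := prod_ne_zero_iff.2 hx
    have e1 := prod_range_succ (fun l : ℕ => x + l) (k + 1)
    have e2 : ∏ l ∈ range (k + 1 + 1), (x + l) = (∏ l ∈ range (k + 1), (x + 1 + l)) * x := by
      rw [prod_range_succ']
      simp [add_assoc, add_comm (1 : ℝ)]
    have hB : ∏ l ∈ range (k + 1), (x + 1 + l) ≠ 0 := fun h => hA' (by rw [e2, h, zero_mul])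
    have hx0 : x ≠ 0 := by simpa using hx 0 (by simp)
    rw [div_sub_div _ _ hA hB, div_eq_div_iff (mul_ne_zero hA hB) hA', Nat.factorial_succ]
    rw [e1] at e2 ⊢
    push_cast at *
    set P := ∏ l ∈ range (k + 1), (x + (l : ℝ))
    set R := ∏ l ∈ range (k + 1), (x + 1 + (l : ℝ))
    have : (R - P) * x = P * (k + 1) := by linear_combination -e2
    apply mul_right_cancel₀ hx0
    linear_combination (k.factorial : ℝ) * P * (x + (k + 1)) * this +
      (k.factorial : ℝ) * P * (k + 1) * e2

/-- The numerators and denominators of the diagonal Padé approximants to `w ^ x` at `w = 1`. -/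
noncomputable def padePoly (x : ℝ) (k : ℕ) (w : ℝ) : ℝ :=
  ∑ p ∈ antidiagonal k, Ring.choose (k + x) p.1 * Ring.choose (k - x) p.2 * w ^ p.1

theorem padePoly_one (x : ℝ) (k : ℕ) : padePoly x k 1 = k.centralBinom := by
  have := Ring.add_choose_eq (R := ℝ) (r := k + x) (s := k - x) k (Commute.all _ _)
  simp only [padePoly, one_pow, mul_one]
  rw [← this, Nat.centralBinom_eq_two_mul_choose, ← Ring.choose_natCast]
  congr 1
  push_cast
  ring

theorem choose_pos_of_lt {x : ℝ} {n : ℕ} (h : (n : ℝ) < x + 1) : 0 < Ring.choose x n := by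
  have h1 := choose_mul_factorial_eq_prod x n
  have h2 : 0 < ∏ m ∈ range n, (x - m) := by
    refine prod_pos fun m hm => ?_
    have : ((m + 1 : ℕ) : ℝ) ≤ n := by exact_mod_cast mem_range.1 hm
    push_cast at this
    linarith
  rw [← h1] at h2
  exact pos_of_mul_pos_left h2 (by positivity)

theorem padePoly_pos {x : ℝ} (hx : |x| < 1) (k : ℕ) {w : ℝ} (hw : 0 < w) : 0 < padePoly x k w := by
  rw [abs_lt] at hx
  refine sum_pos (fun p hp => ?_) ⟨(0, k), by simp⟩
  have hk : (p.1 : ℝ) + p.2 = k := by exact_mod_cast mem_antidiagonal.1 hp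
  have h1 : (0 : ℝ) ≤ p.1 := by positivity
  have h2 : (0 : ℝ) ≤ p.2 := by positivity
  have := choose_pos_of_lt (x := k + x) (n := p.1) (by linarith)
  have := choose_pos_of_lt (x := k - x) (n := p.2) (by linarith)
  positivity

theorem padePoly_le {x : ℝ} (hx : |x| < 1) (k : ℕ) {w : ℝ} (hw : 0 < w) (hw1 : w ≤ 1) :
    padePoly x k w ≤ k.centralBinom := by
  rw [← padePoly_one x]
  rw [abs_lt] at hx
  refine sum_le_sum fun p hp => ?_
  have hk : (p.1 : ℝ) + p.2 = k := by exact_mod_cast mem_antidiagonal.1 hp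
  have h1 : (0 : ℝ) ≤ p.1 := by positivity
  have h2 : (0 : ℝ) ≤ p.2 := by positivity
  have := choose_pos_of_lt (x := k + x) (n := p.1) (by linarith)
  have := choose_pos_of_lt (x := k - x) (n := p.2) (by linarith)
  gcongr

/-- The constant relating the Padé remainder to its integral representation. -/
noncomputable def padeConst (x : ℝ) (k : ℕ) : ℝ :=
  x * ∏ m ∈ range k, (((m : ℝ) + 1) ^ 2 - x ^ 2)

theorem prod_mul_prod_mul_prod_eq (x : ℝ) {k : ℕ} (i j : ℕ) (h : i + j = k) :
    (∏ l ∈ range (k + 1), (-i - x + l)) * (∏ m ∈ range j, (k + x - m)) *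
      (∏ m ∈ range i, (k - x - m)) = (-1) ^ (i + 1) * padeConst x k := by
  induction i generalizing j with
  | zero =>
    obtain rfl : j = k := by omega
    have h1 : ∏ m ∈ range j, ((j : ℝ) + x - m) = ∏ m ∈ range j, ((m : ℝ) + 1 + x) := by
      rw [← prod_range_reflect]
      refine prod_congr rfl fun m hm => ?_
      have hm' := mem_range.1 hm
      have : ((j - 1 - m : ℕ) : ℝ) = j - 1 - m := by
        rw [Nat.cast_sub (by omega), Nat.cast_sub (by omega), Nat.cast_one]
      rw [this]
      ring
    rw [prod_range_succ', h1, padeConst]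
    have h2 : ∏ m ∈ range j, (((m : ℝ) + 1) ^ 2 - x ^ 2) =
        (∏ m ∈ range j, (-((0 : ℕ) : ℝ) - x + ((m + 1 : ℕ) : ℝ))) *
          ∏ m ∈ range j, ((m : ℝ) + 1 + x) := by
      rw [← prod_mul_distrib]
      refine prod_congr rfl fun m _ => ?_
      push_cast
      ring
    rw [h2]
    simp
    ring
  | succ i ih =>
    have := ih (j + 1) (by omega)
    have e1 : ∏ l ∈ range (k + 1), (-((i + 1 : ℕ) : ℝ) - x + l) =
        (∏ l ∈ range k, (-(i : ℝ) - x + l)) * (-(i + 1) - x) := by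
      rw [prod_range_succ']
      congr 1
      · refine prod_congr rfl fun m _ => ?_
        push_cast
        ring
      · push_cast
        ring
    rw [prod_range_succ, prod_range_succ] at this
    rw [e1, prod_range_succ]
    have hk : (k : ℝ) = i + 1 + j := by exact_mod_cast (by omega : k = i + 1 + j)
    rw [pow_succ, mul_assoc, mul_comm (-1 : ℝ), mul_assoc] at *
    set P := ∏ l ∈ range k, (-(i : ℝ) - x + l)
    set Q := ∏ m ∈ range j, ((k : ℝ) + x - m)
    set S := ∏ m ∈ range i, ((k : ℝ) - x - m)
    have e3 : (-(i : ℝ) - x + k) = k - x - i := by ring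
    have e4 : (k : ℝ) + x - j = i + 1 + x := by rw [hk]; ring
    rw [e3, e4] at this
    linear_combination -this

theorem padeConst_pos {x : ℝ} (hx0 : 0 < x) (hx1 : x < 1) (k : ℕ) : 0 < padeConst x k := by
  refine mul_pos hx0 (prod_pos fun m _ => ?_)
  have : (0 : ℝ) ≤ m := by positivity
  nlinarith

theorem padeConst_le {x : ℝ} (hx0 : 0 < x) (hx1 : x < 1) (k : ℕ) :
    padeConst x k ≤ x * (k.factorial : ℝ) ^ 2 := by
  rw [padeConst]
  gcongr
  rw [← prod_range_add_one_eq_factorial, Nat.cast_prod, ← prod_pow]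
  refine prod_le_prod (fun m _ => ?_) fun m _ => ?_
  · have : (0 : ℝ) ≤ m := by positivity
    nlinarith
  · push_cast
    nlinarith [sq_nonneg x]

theorem padeConst_mul_sum_left {x : ℝ} (hx0 : 0 < x) (hx1 : x < 1) {k : ℕ} (i j : ℕ)
    (h : i + j = k) :
    padeConst x k * ((-1) ^ i * (k.choose i : ℝ) *
      ∑ l ∈ range (k + 1), (-1) ^ l * (k.choose l : ℝ) / (-i - x + l)) =
    -((k.factorial : ℝ) ^ 2 * (Ring.choose (k + -x) i * Ring.choose (k - -x) j)) := by
  have hP := padeConst_pos hx0 hx1 k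
  have hprod := prod_mul_prod_mul_prod_eq x i j h
  have hne : ∀ l ∈ range (k + 1), -(i : ℝ) - x + l ≠ 0 := by
    intro l hl h0
    have : ∏ l ∈ range (k + 1), (-(i : ℝ) - x + l) = 0 := prod_eq_zero hl h0
    rw [this] at hprod
    simp only [zero_mul] at hprod
    exact (mul_ne_zero (pow_ne_zero _ (by norm_num)) hP.ne') hprod.symm
  rw [sum_neg_one_pow_mul_choose_div k _ hne]
  have hR := prod_ne_zero_iff.2 hne
  rw [sub_neg_eq_add, ← sub_eq_add_neg]
  have c1 := choose_mul_factorial_eq_prod ((k : ℝ) - x) i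
  have c2 := choose_mul_factorial_eq_prod ((k : ℝ) + x) j
  rw [← c1, ← c2] at hprod
  have hc : (k.choose i : ℝ) * i.factorial * j.factorial = k.factorial := by
    have := Nat.choose_mul_factorial_mul_factorial (n := k) (k := i) (by omega)
    rw [show k - i = j by omega] at this
    exact_mod_cast this
  rw [← mul_div_assoc, ← mul_div_assoc, div_eq_iff hR]
  have hs : ((-1 : ℝ) ^ i) * (-1) ^ i = 1 := by rw [← mul_pow]; simp
  rw [pow_succ] at hprod
  set R := ∏ l ∈ range (k + 1), (-(i : ℝ) - x + l)
  have hi : (i.factorial : ℝ) ≠ 0 := by positivity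
  have hj : (j.factorial : ℝ) ≠ 0 := by positivity
  have hprod' : padeConst x k * (-1) ^ i =
      -(R * (Ring.choose ((k : ℝ) + x) j * j.factorial) *
        (Ring.choose ((k : ℝ) - x) i * i.factorial)) := by
    linear_combination hprod
  calc _ = padeConst x k * (-1) ^ i * (k.choose i * k.factorial) := by ring
    _ = _ := by
      rw [hprod', ← hc]
      ring

theorem padeConst_mul_sum_right {x : ℝ} (hx0 : 0 < x) (hx1 : x < 1) {k : ℕ} (i j : ℕ)
    (h : i + j = k) :
    padeConst x k * ((-1) ^ i * (k.choose i : ℝ) *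
      ∑ l ∈ range (k + 1), (-1) ^ l * (k.choose l : ℝ) / (i - x - l)) =
    -((k.factorial : ℝ) ^ 2 * (Ring.choose (k + x) i * Ring.choose (k - x) j)) := by
  have := padeConst_mul_sum_left (k := k) hx0 hx1 j i (by omega)
  rw [mul_comm (Ring.choose _ j), sub_neg_eq_add, ← sub_eq_add_neg] at this
  rw [← this, ← sum_range_reflect]
  congr 1
  rw [mul_sum, mul_sum]
  refine sum_congr rfl fun l hl => ?_
  have hl' : l ≤ k := by simpa [Nat.lt_succ_iff] using hl
  have e1 : k + 1 - 1 - l = k - l := by omega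
  have e2 : k.choose i = k.choose j := by
    exact Nat.choose_symm_of_eq_add h.symm
  have hk : (k : ℝ) = i + j := by exact_mod_cast h.symm
  have e3 : (i : ℝ) - x - (k - l : ℕ) = -j - x + l := by
    rw [Nat.cast_sub hl', hk]; ring
  rw [e1, Nat.choose_symm hl', e2, e3]
  have e4 : ((-1 : ℝ)) ^ i * (-1) ^ (k - l) = (-1) ^ j * (-1) ^ l := by
    rw [← pow_add, ← pow_add]
    apply neg_one_pow_congr
    rw [Nat.even_add, Nat.even_add, Nat.even_sub hl', ← h, Nat.even_add]
    tauto
  rw [← mul_div_assoc, ← mul_div_assoc]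
  congr 1
  linear_combination (k.choose j * k.choose l : ℝ) * e4

theorem integrand_eq_sum {x w u : ℝ} (hu : 0 < u) (k : ℕ) :
    (1 - u) ^ k * (u - w) ^ k * u ^ (-x - k - 1) =
      ∑ i ∈ range (k + 1), ∑ l ∈ range (k + 1),
        (-1) ^ i * (k.choose i : ℝ) * w ^ i * ((-1) ^ l * k.choose l) * u ^ ((l : ℝ) - i - x - 1) := by
  have h1 : (1 - u) ^ k = ∑ l ∈ range (k + 1), (-1) ^ l * (k.choose l : ℝ) * u ^ l := by
    rw [sub_eq_neg_add, add_pow]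
    refine sum_congr rfl fun l _ => ?_
    rw [neg_pow]; ring
  have h2 : (u - w) ^ k = ∑ i ∈ range (k + 1), (-1) ^ i * (k.choose i : ℝ) * w ^ i * u ^ (k - i) := by
    rw [sub_eq_neg_add, add_pow]
    refine sum_congr rfl fun l _ => ?_
    rw [neg_pow]; ring
  rw [mul_comm ((1 - u) ^ k), h1, h2, sum_mul_sum, sum_mul]
  refine sum_congr rfl fun i hi => ?_
  rw [sum_mul]
  refine sum_congr rfl fun l _ => ?_
  have hi' : i ≤ k := by simpa [Nat.lt_succ_iff] using hi
  have : u ^ ((l : ℝ) - i - x - 1) = u ^ (k - i) * u ^ l * u ^ (-x - k - 1) := by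
    rw [← Real.rpow_natCast, ← Real.rpow_natCast, ← Real.rpow_add hu, ← Real.rpow_add hu,
      Nat.cast_sub hi']
    congr 1
    ring
  rw [this]
  ring

theorem padePoly_sub_eq_integral {x : ℝ} (hx0 : 0 < x) (hx1 : x < 1) {w : ℝ} (hw0 : 0 < w)
    (hw1 : w < 1) (k : ℕ) :
    (k.factorial : ℝ) ^ 2 * (w ^ (-x) * padePoly x k w - padePoly (-x) k w) =
      padeConst x k * ∫ u in w..1, (1 - u) ^ k * (u - w) ^ k * u ^ (-x - k - 1) := by
  have hpos : ∀ u ∈ Set.uIcc w 1, 0 < u := fun u hu => by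
    rw [Set.uIcc_of_le hw1.le] at hu
    exact hw0.trans_le hu.1
  have h0 : (0 : ℝ) ∉ Set.uIcc w 1 := fun h => lt_irrefl _ (hpos 0 h)
  have hne : ∀ i l : ℕ, (l : ℝ) - i - x ≠ 0 := by
    intro i l h
    have h1 : (((l : ℤ) - i : ℤ) : ℝ) = x := by push_cast; linarith
    have h2 : (0 : ℤ) < (l : ℤ) - i := by
      have : (0 : ℝ) < (((l : ℤ) - i : ℤ) : ℝ) := by rw [h1]; exact hx0
      exact_mod_cast this
    have h3 : (l : ℤ) - i < 1 := by
      have : (((l : ℤ) - i : ℤ) : ℝ) < 1 := by rw [h1]; exact hx1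
      exact_mod_cast this
    omega
  have hJ : ∫ u in w..1, (1 - u) ^ k * (u - w) ^ k * u ^ (-x - k - 1) =
      ∑ i ∈ range (k + 1), ∑ l ∈ range (k + 1),
        (-1) ^ i * (k.choose i : ℝ) * w ^ i * ((-1) ^ l * k.choose l) *
          ((1 - w ^ ((l : ℝ) - i - x)) / (l - i - x)) := by
    rw [intervalIntegral.integral_congr (g := fun u => ∑ i ∈ range (k + 1), ∑ l ∈ range (k + 1),
        (-1) ^ i * (k.choose i : ℝ) * w ^ i * ((-1) ^ l * k.choose l) * u ^ ((l : ℝ) - i - x - 1))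
        (fun u hu => integrand_eq_sum (hpos u hu) k)]
    have hint : ∀ i l : ℕ, IntervalIntegrable (fun u : ℝ =>
        (-1) ^ i * (k.choose i : ℝ) * w ^ i * ((-1) ^ l * k.choose l) * u ^ ((l : ℝ) - i - x - 1))
        MeasureTheory.volume w 1 := fun i l =>
      (intervalIntegral.intervalIntegrable_rpow (Or.inr h0)).const_mul _
    have hint' : ∀ i : ℕ, IntervalIntegrable (fun u : ℝ => ∑ l ∈ range (k + 1),
        (-1) ^ i * (k.choose i : ℝ) * w ^ i * ((-1) ^ l * k.choose l) * u ^ ((l : ℝ) - i - x - 1))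
        MeasureTheory.volume w 1 := fun i => by
      have := IntervalIntegrable.sum (range (k + 1)) fun l _ => hint i l
      simpa only [sum_fn] using this
    rw [intervalIntegral.integral_finsetSum fun i _ => hint' i]
    refine sum_congr rfl fun i _ => ?_
    rw [intervalIntegral.integral_finsetSum fun l _ => hint i l]
    refine sum_congr rfl fun l _ => ?_
    rw [intervalIntegral.integral_const_mul, integral_rpow (Or.inr ⟨fun h => hne i l (by linarith), h0⟩)]
    simp
  have hL : ∑ i ∈ range (k + 1), ∑ l ∈ range (k + 1),
        (-1) ^ i * (k.choose i : ℝ) * w ^ i * ((-1) ^ l * k.choose l) *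
          ((1 - w ^ ((l : ℝ) - i - x)) / (l - i - x)) =
      (∑ i ∈ range (k + 1), ((-1) ^ i * (k.choose i : ℝ) *
        ∑ l ∈ range (k + 1), (-1) ^ l * (k.choose l : ℝ) / (-i - x + l)) * w ^ i) -
      w ^ (-x) * ∑ i ∈ range (k + 1), ((-1) ^ i * (k.choose i : ℝ) *
        ∑ l ∈ range (k + 1), (-1) ^ l * (k.choose l : ℝ) / (i - x - l)) * w ^ i := by
    have hR : ∑ i ∈ range (k + 1), ((-1) ^ i * (k.choose i : ℝ) *
        ∑ l ∈ range (k + 1), (-1) ^ l * (k.choose l : ℝ) / (i - x - l)) * w ^ i =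
        ∑ i ∈ range (k + 1), ∑ l ∈ range (k + 1), (-1) ^ l * (k.choose l : ℝ) *
          ((-1) ^ i * (k.choose i : ℝ) / (l - x - i)) * w ^ l := by
      rw [sum_comm]
      refine sum_congr rfl fun i _ => ?_
      rw [mul_sum, sum_mul]
    rw [hR, mul_sum, ← sum_sub_distrib]
    refine sum_congr rfl fun i _ => ?_
    rw [mul_sum, sum_mul, mul_sum, ← sum_sub_distrib]
    refine sum_congr rfl fun l _ => ?_
    have e : w ^ i * w ^ ((l : ℝ) - i - x) = w ^ (-x) * w ^ l := by
      rw [← Real.rpow_natCast, ← Real.rpow_natCast, ← Real.rpow_add hw0, ← Real.rpow_add hw0]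
      congr 1
      ring
    have e1 : -(i : ℝ) - x + l = l - i - x := by ring
    have e2 : (l : ℝ) - x - i = l - i - x := by ring
    rw [e1, e2]
    have := hne i l
    field_simp
    linear_combination -(k.choose i * k.choose l : ℝ) * e
  have key : ∀ y : ℝ, ∀ f : ℕ → ℝ, (∀ i j, i + j = k → padeConst x k * f i =
      -((k.factorial : ℝ) ^ 2 * (Ring.choose (k + y) i * Ring.choose (k - y) j))) →
      padeConst x k * ∑ i ∈ range (k + 1), f i * w ^ i =
        -((k.factorial : ℝ) ^ 2 * padePoly y k w) := by
    intro y f hf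
    rw [padePoly, Nat.sum_antidiagonal_eq_sum_range_succ_mk, mul_sum, mul_sum, ← sum_neg_distrib]
    refine sum_congr rfl fun i hi => ?_
    have hi' : i ≤ k := by simpa [Nat.lt_succ_iff] using hi
    rw [← mul_assoc, hf i (k - i) (by omega)]
    ring
  rw [hJ, hL, mul_sub (padeConst x k), mul_left_comm (padeConst x k), key (-x) _ (padeConst_mul_sum_left hx0 hx1),
    key x _ (padeConst_mul_sum_right hx0 hx1)]
  ring

theorem padePoly_sub_nonneg_and_le {x : ℝ} (hx0 : 0 < x) (hx1 : x < 1) {w : ℝ} (hw0 : 0 < w)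
    (hw1 : w < 1) (k : ℕ) :
    0 ≤ w ^ (-x) * padePoly x k w - padePoly (-x) k w ∧
      w ^ (-x) * padePoly x k w - padePoly (-x) k w ≤
        x * (((1 - w) ^ 2 / 4) ^ k * w ^ (-x - k - 1) * (1 - w)) := by
  have h := padePoly_sub_eq_integral hx0 hx1 hw0 hw1 k
  set J := ∫ u in w..1, (1 - u) ^ k * (u - w) ^ k * u ^ (-x - k - 1) with hJ
  set E := w ^ (-x) * padePoly x k w - padePoly (-x) k w
  have hJ0 : 0 ≤ J := by
    refine intervalIntegral.integral_nonneg hw1.le fun u hu => ?_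
    have : 0 ≤ 1 - u := by linarith [hu.2]
    have : 0 ≤ u - w := by linarith [hu.1]
    have : 0 < u := hw0.trans_le hu.1
    positivity
  have hJ1 : J ≤ ((1 - w) ^ 2 / 4) ^ k * w ^ (-x - k - 1) * (1 - w) := by
    have hb : ∀ u ∈ Set.uIoc w 1, ‖(1 - u) ^ k * (u - w) ^ k * u ^ (-x - k - 1)‖ ≤
        ((1 - w) ^ 2 / 4) ^ k * w ^ (-x - k - 1) := by
      intro u hu
      rw [Set.uIoc_of_le hw1.le] at hu
      have h1 : 0 ≤ 1 - u := by linarith [hu.2]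
      have h2 : 0 ≤ u - w := by linarith [hu.1]
      have h3 : 0 < u := hw0.trans hu.1
      rw [Real.norm_of_nonneg (by positivity), ← mul_pow]
      have h4 : (1 - u) * (u - w) ≤ (1 - w) ^ 2 / 4 := by nlinarith [sq_nonneg (1 - u - (u - w))]
      have h5 : u ^ (-x - k - 1) ≤ w ^ (-x - k - 1) :=
        Real.rpow_le_rpow_of_nonpos hw0 hu.1.le (by linarith [k.cast_nonneg (α := ℝ)])
      gcongr
    have := intervalIntegral.norm_integral_le_of_norm_le_const hb
    rw [abs_of_pos (by linarith), ← hJ, Real.norm_of_nonneg hJ0] at this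
    exact this
  have hf : (0 : ℝ) < (k.factorial : ℝ) ^ 2 := by positivity
  have hc := padeConst_pos hx0 hx1 k
  have hc' := padeConst_le hx0 hx1 k
  constructor
  · have : 0 ≤ (k.factorial : ℝ) ^ 2 * E := by rw [h]; positivity
    exact nonneg_of_mul_nonneg_right this hf
  · refine le_of_mul_le_mul_left ?_ hf
    rw [h]
    calc padeConst x k * J ≤ (x * (k.factorial : ℝ) ^ 2) * _ := mul_le_mul hc' hJ1 hJ0 (by positivity)
      _ = _ := by ring

theorem factorial_dvd_prod_sub (x : ℤ) (n : ℕ) : (n.factorial : ℤ) ∣ ∏ m ∈ range n, (x - m) := by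
  have h1 := Ring.descPochhammer_eq_factorial_smul_choose x n
  have h2 : ∀ n, (descPochhammer ℤ n).smeval x = ∏ m ∈ range n, (x - (m : ℤ)) := by
    intro n
    induction n with
    | zero => simp
    | succ n ih =>
      rw [descPochhammer_succ_right, Polynomial.smeval_mul, ih, prod_range_succ]
      simp [Polynomial.smeval_sub, Polynomial.smeval_natCast]
  rw [← h2, h1]
  exact ⟨_, nsmul_eq_mul _ _⟩

theorem factorial_dvd_pow_padicValNat_mul_prod {q : ℕ} (hq : q.Prime) (x : ℤ) (n : ℕ) :
    (n.factorial : ℤ) ∣ (q : ℤ) ^ padicValNat q n.factorial * ∏ m ∈ range n, (x - q * m) := by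
  obtain ⟨s, t, ht, hst⟩ := Nat.exists_eq_pow_mul_and_not_dvd n.factorial_ne_zero q hq.ne_one
  have hs : padicValNat q n.factorial = s := by
    have := Fact.mk hq
    rw [hst, padicValNat.mul (pow_ne_zero _ hq.ne_zero) (by rintro rfl; simp at ht),
      padicValNat.prime_pow, padicValNat.eq_zero_of_not_dvd ht, add_zero]
  rw [hs, hst]
  push_cast
  refine mul_dvd_mul_left _ ?_
  have hc : IsCoprime (q : ℤ) t := Nat.isCoprime_iff_coprime.2 ((Nat.Prime.coprime_iff_not_dvd hq).2 ht)
  obtain ⟨a, b, hab⟩ := hc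
  have h1 : (t : ℤ) ∣ ∏ m ∈ range n, (a * x - m) :=
    (Int.natCast_dvd_natCast.2 (Dvd.intro_left (q ^ s) hst.symm)).trans
      (factorial_dvd_prod_sub (a * x) n)
  have h2 : (∏ m ∈ range n, (x - q * m)) ≡ (∏ m ∈ range n, (q * (a * x - m))) [ZMOD t] := by
    refine Int.ModEq.prod fun m _ => ?_
    rw [Int.modEq_iff_dvd]
    exact ⟨-(b * x), by linear_combination x * hab⟩
  rw [prod_mul_distrib] at h2
  exact Int.modEq_zero_iff_dvd.1 (h2.trans (Int.modEq_zero_iff_dvd.2 (h1.mul_left _)))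

theorem exists_int_eq_pow_mul_choose {q : ℕ} (hq : q.Prime) {y : ℝ} {z : ℤ} (hy : q * y = z)
    (n : ℕ) : ∃ c : ℤ, (q : ℝ) ^ (n + padicValNat q n.factorial) * Ring.choose y n = c := by
  obtain ⟨c, hc⟩ := factorial_dvd_pow_padicValNat_mul_prod hq z n
  refine ⟨c, ?_⟩
  have h1 := choose_mul_factorial_eq_prod y n
  have h2 : (q : ℝ) ^ n * ∏ m ∈ range n, (y - m) = ∏ m ∈ range n, ((z : ℝ) - q * m) := by
    rw [← hy, ← card_range n, ← prod_const, card_range, ← prod_mul_distrib]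
    exact prod_congr rfl fun m _ => by ring
  have h3 : (q : ℝ) ^ padicValNat q n.factorial * ∏ m ∈ range n, ((z : ℝ) - q * m) =
      n.factorial * c := by exact_mod_cast hc
  have hn : (n.factorial : ℝ) ≠ 0 := by positivity
  apply mul_left_cancel₀ hn
  rw [← h3, ← h2, ← h1]
  ring

theorem exists_int_eq_padePoly {q : ℕ} (hq : q.Prime) {x : ℝ} {z : ℤ} (hx : q * x = z)
    (k : ℕ) {A : ℤ} (hA : A ≠ 0) :
    ∃ c : ℤ, (q : ℝ) ^ (k + padicValNat q k.factorial) * (A : ℝ) ^ k *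
      padePoly x k (((A : ℝ) - 1) / A) = c := by
  have hA' : (A : ℝ) ≠ 0 := by exact_mod_cast hA
  have key : ∀ p ∈ antidiagonal k, ∃ c : ℤ, (q : ℝ) ^ (k + padicValNat q k.factorial) *
      (A : ℝ) ^ k * (Ring.choose (k + x) p.1 * Ring.choose (k - x) p.2 *
        (((A : ℝ) - 1) / A) ^ p.1) = c := by
    rintro ⟨i, j⟩ hp
    obtain rfl : i + j = k := by simpa using hp
    obtain ⟨c, hc⟩ := exists_int_eq_pow_mul_choose hq (y := (i + j : ℕ) + x) (z := q * (i + j : ℕ) + z)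
      (by push_cast; rw [← hx]; ring) i
    obtain ⟨d, hd⟩ := exists_int_eq_pow_mul_choose hq (y := (i + j : ℕ) - x) (z := q * (i + j : ℕ) - z)
      (by push_cast; rw [← hx]; ring) j
    have := Fact.mk hq
    have hv : padicValNat q i.factorial + padicValNat q j.factorial ≤
        padicValNat q (i + j).factorial := by
      rw [← padicValNat.mul i.factorial_ne_zero j.factorial_ne_zero]
      exact (padicValNat_dvd_iff_le (i + j).factorial_ne_zero).1
        (pow_padicValNat_dvd.trans (Nat.factorial_mul_factorial_dvd_factorial_add i j))
    obtain ⟨e, he⟩ := Nat.exists_eq_add_of_le hv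
    refine ⟨q ^ e * c * d * (A - 1) ^ i * A ^ j, ?_⟩
    push_cast at hc hd ⊢
    rw [he, ← hc, ← hd, div_pow]
    field_simp
    ring
  choose! f hf using key
  refine ⟨∑ p ∈ antidiagonal k, f p, ?_⟩
  rw [padePoly, mul_sum]
  push_cast
  exact sum_congr rfl hf

theorem mul_pow_mul_sub_le_pow_sub_pow {s t : ℝ} (ht : 0 < t) (hs : t ≤ s) (n : ℕ) :
    (n + 1) * t ^ n * (s - t) ≤ s ^ (n + 1) - t ^ (n + 1) := by
  have hst : 0 ≤ s / t := div_nonneg (ht.le.trans hs) ht.le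
  have h := one_add_mul_sub_le_pow (a := s / t) (by linarith) (n + 1)
  rw [div_pow, le_div_iff₀ (by positivity)] at h
  have : (1 + ((n + 1 : ℕ) : ℝ) * (s / t - 1)) * t ^ (n + 1) =
      t ^ (n + 1) + (n + 1) * t ^ n * (s - t) := by
    push_cast
    field_simp
    ring
  linarith

/-- The gap principle given by a diagonal Padé approximation to `(1 - 1 / A) ^ (1 / q)`. -/
theorem one_le_of_mul_pow_sub_one_eq {q : ℕ} (hq : q.Prime) {A b c : ℤ} (hA : 1 < A) (hb : 0 < b)
    (hc : 0 < c) (h : A * c ^ q - 1 = (A - 1) * b ^ q) (k : ℕ) :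
    (1 : ℝ) ≤ (q : ℝ) ^ (k + padicValNat q k.factorial) * k.centralBinom * (A : ℝ) ^ (k + 1) /
        (q * (A - 1) * (b : ℝ) ^ (q - 1)) +
      (q : ℝ) ^ (k + padicValNat q k.factorial) * b * ((q - 1) / q) * (A / (A - 1)) /
        (4 * ((A : ℝ) - 1)) ^ k := by
  obtain ⟨n, rfl⟩ : ∃ n, q = n + 1 := ⟨q - 1, by have := hq.pos; omega⟩
  have hn : (0 : ℝ) < n := by have := hq.two_le; exact_mod_cast (by omega : 0 < n)
  have hA1 : (0 : ℝ) < (A : ℝ) - 1 := sub_pos.2 (by exact_mod_cast hA)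
  have hA0 : (0 : ℝ) < A := by linarith
  have hb' : (0 : ℝ) < b := by exact_mod_cast hb
  have hc' : (0 : ℝ) < c := by exact_mod_cast hc
  have h' : (A : ℝ) * (c : ℝ) ^ (n + 1) - 1 = (A - 1) * (b : ℝ) ^ (n + 1) := by exact_mod_cast h
  set v := k + padicValNat (n + 1) k.factorial
  set x : ℝ := n / (n + 1) with hxdef
  have hx0 : 0 < x := by positivity
  have hx1 : x < 1 := by rw [hxdef, div_lt_one (by positivity)]; linarith
  have hxa : |x| < 1 := by rw [abs_of_pos hx0]; exact hx1
  set w : ℝ := ((A : ℝ) - 1) / A with hwdef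
  have hw0 : 0 < w := by positivity
  have hw1 : w < 1 := by rw [hwdef, div_lt_one hA0]; linarith
  obtain ⟨c₁, hc₁⟩ := exists_int_eq_padePoly hq (x := x) (z := n)
    (by rw [hxdef]; push_cast; field_simp) k (A := A) (by omega)
  obtain ⟨c₂, hc₂⟩ := exists_int_eq_padePoly hq (x := -x) (z := -n)
    (by rw [hxdef]; push_cast; field_simp) k (A := A) (by omega)
  rw [← hwdef] at hc₁ hc₂
  obtain ⟨hE0, hE1⟩ := padePoly_sub_nonneg_and_le hx0 hx1 hw0 hw1 k
  have hQ0 := padePoly_pos hxa k hw0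
  have hQ1 := padePoly_le hxa k hw0 hw1.le
  set Q := padePoly x k w
  set P := padePoly (-x) k w
  set E := w ^ (-x) * Q - P with hE
  set θ := w ^ (1 - x) with hθ
  have hθ0 : 0 < θ := by positivity
  have hθ1 : θ ≤ 1 := Real.rpow_le_one hw0.le hw1.le (by linarith)
  have hθw : w * w ^ (-x) = θ := by
    rw [hθ, sub_eq_add_neg, Real.rpow_add hw0, Real.rpow_one]
  have hθq : θ ^ (n + 1) = w := by
    rw [hθ, ← Real.rpow_natCast, ← Real.rpow_mul hw0.le]
    have : (1 - x) * (n + 1 : ℕ) = 1 := by rw [hxdef]; push_cast; field_simp; ring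
    rw [this, Real.rpow_one]
  have ht : (θ * b) ^ (n + 1) = (c : ℝ) ^ (n + 1) - 1 / A := by
    rw [mul_pow, hθq, hwdef]
    field_simp
    linarith
  have htc : θ * b < c := by
    refine lt_of_pow_lt_pow_left₀ (n + 1) hc'.le ?_
    rw [ht]
    have : 0 < 1 / (A : ℝ) := by positivity
    linarith
  have hgap : (n + 1) * (A - 1) * (b : ℝ) ^ n * (c - θ * b) ≤ 1 := by
    have h1 := mul_pow_mul_sub_le_pow_sub_pow (by positivity) htc.le n
    rw [ht] at h1
    have h2 : w ≤ θ ^ n := by rw [← hθq]; exact pow_le_pow_of_le_one hθ0.le hθ1 (by omega)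
    have h3 : 0 < (c : ℝ) - θ * b := by linarith
    calc (n + 1) * (A - 1) * (b : ℝ) ^ n * (c - θ * b)
        = A * ((n + 1) * (w * (b : ℝ) ^ n) * (c - θ * b)) := by rw [hwdef]; field_simp
      _ ≤ A * ((n + 1) * (θ ^ n * (b : ℝ) ^ n) * (c - θ * b)) := by gcongr
      _ ≤ A * (1 / A) := by
        gcongr
        rw [← mul_pow]
        linarith
      _ = 1 := by field_simp
  have hΛ : ((A * c₁ * c - (A - 1) * c₂ * b : ℤ) : ℝ) =
      ((n + 1 : ℕ) : ℝ) ^ v * (A : ℝ) ^ (k + 1) * (Q * (c - θ * b) + b * (w * E)) := by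
    push_cast
    push_cast at hc₁ hc₂
    rw [← hc₁, ← hc₂, hE, mul_sub w, ← mul_assoc w, hθw]
    have : (A : ℝ) - 1 = A * w := by rw [hwdef]; field_simp
    rw [this]
    ring
  have hpos : (0 : ℝ) < ((A * c₁ * c - (A - 1) * c₂ * b : ℤ) : ℝ) := by
    rw [hΛ]
    have : 0 < (c : ℝ) - θ * b := by linarith
    positivity
  have hone : (1 : ℝ) ≤ ((A * c₁ * c - (A - 1) * c₂ * b : ℤ) : ℝ) := by
    have h0 : 0 < A * c₁ * c - (A - 1) * c₂ * b := by exact_mod_cast hpos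
    exact_mod_cast h0
  refine hone.trans ?_
  rw [hΛ, mul_add]
  refine add_le_add ?_ ?_
  · rw [le_div_iff₀ (by push_cast; positivity)]
    rw [Nat.add_sub_cancel]
    have h3 : 0 ≤ (c : ℝ) - θ * b := by linarith
    calc _ = ((n + 1 : ℕ) : ℝ) ^ v * (A : ℝ) ^ (k + 1) * Q *
          ((n + 1) * (A - 1) * (b : ℝ) ^ n * (c - θ * b)) := by push_cast; ring
      _ ≤ ((n + 1 : ℕ) : ℝ) ^ v * (A : ℝ) ^ (k + 1) * k.centralBinom * 1 := by gcongr
      _ = _ := by ring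
  · have h4 : w * E ≤ x * ((1 / (4 * (A : ℝ) ^ 2)) ^ k * (A / (A - 1)) ^ (k + 1) / A) := by
      have e1 : 1 - w = 1 / A := by rw [hwdef]; field_simp; ring
      have e2 : w * w ^ (-x - k - 1) ≤ (A / (A - 1)) ^ (k + 1) := by
        have e3 : w * w ^ (-x - k - 1) = w ^ (-x - k) := by
          nth_rewrite 1 [← Real.rpow_one w]
          rw [← Real.rpow_add hw0]
          congr 1
          ring
        have e4 : ((A : ℝ) / (A - 1)) ^ (k + 1) = w ^ (-((k + 1 : ℕ) : ℝ)) := by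
          rw [Real.rpow_neg hw0.le, Real.rpow_natCast, ← inv_pow, hwdef, inv_div]
        rw [e3, e4]
        refine Real.rpow_le_rpow_of_exponent_ge hw0 hw1.le ?_
        push_cast
        linarith
      rw [e1] at hE1
      calc w * E ≤ w * (x * (((1 / (A : ℝ)) ^ 2 / 4) ^ k * w ^ (-x - k - 1) * (1 / A))) := by gcongr
        _ = x * ((1 / (4 * (A : ℝ) ^ 2)) ^ k * (w * w ^ (-x - k - 1)) / A) := by
          rw [show (1 / (A : ℝ)) ^ 2 / 4 = 1 / (4 * (A : ℝ) ^ 2) by field_simp]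
          ring
        _ ≤ _ := by gcongr
    calc _ ≤ ((n + 1 : ℕ) : ℝ) ^ v * (A : ℝ) ^ (k + 1) *
          (b * (x * ((1 / (4 * (A : ℝ) ^ 2)) ^ k * (A / (A - 1)) ^ (k + 1) / A))) := by gcongr
      _ = _ := by
        rw [hxdef]
        push_cast
        rw [mul_pow 4, div_pow, div_pow, mul_pow]
        field_simp
        ring

theorem le_and_mul_sub_one_le_of_mul_pow_sub_one_eq {q : ℕ} (hq : q ≠ 0) {A b c : ℤ} (hA : 1 < A)
    (hb : 0 < b) (hc : 0 < c) (h : A * c ^ q - 1 = (A - 1) * b ^ q) :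
    c ≤ b ∧ b * (A - 1) ≤ c * A := by
  constructor
  · by_contra! hlt
    have h1 : b ^ q < c ^ q := pow_lt_pow_left₀ hlt hb.le hq
    have h2 : 0 < b ^ q := by positivity
    nlinarith
  · refine le_of_pow_le_pow_left₀ hq (by positivity) ?_
    rw [mul_pow, mul_pow]
    have h1 : (A - 1) * (A - 1) ^ (q - 1) = (A - 1) ^ q := mul_pow_sub_one hq _
    have h2 : A * A ^ (q - 1) = A ^ q := mul_pow_sub_one hq _
    have h3 : (A - 1) ^ (q - 1) ≤ A ^ (q - 1) := pow_le_pow_left₀ (by omega) (by omega) _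
    have h4 : 0 < (A - 1) ^ (q - 1) := pow_pos (by omega) _
    calc b ^ q * (A - 1) ^ q = (A * c ^ q - 1) * (A - 1) ^ (q - 1) := by rw [h, ← h1]; ring
      _ ≤ (A * c ^ q) * A ^ (q - 1) := by gcongr; omega
      _ = _ := by rw [← h2]; ring

theorem one_le_of_mul_pow_sub_one_eq' {q : ℕ} (hq : q.Prime) {A b c : ℤ} (hA : 1 < A) (hb : 0 < b)
    (hc : 0 < c) (h : A * c ^ q - 1 = (A - 1) * b ^ q) (k : ℕ) {r s : ℝ}
    (hr : (A : ℝ) ≤ r * (A - 1)) (hs : (q : ℝ) ^ padicValNat q k.factorial ≤ s) :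
    (1 : ℝ) ≤ r * (q ^ k * s * k.centralBinom * (A : ℝ) ^ k) / (q * (c : ℝ) ^ (q - 1)) +
      (q - 1) / q * r ^ 2 * s * c * (q * r / (4 * A)) ^ k := by
  refine (one_le_of_mul_pow_sub_one_eq hq hA hb hc h k).trans ?_
  obtain ⟨hcb, hbc⟩ := le_and_mul_sub_one_le_of_mul_pow_sub_one_eq hq.ne_zero hA hb hc h
  have hq1 : (1 : ℝ) < q := by exact_mod_cast hq.one_lt
  have hA1 : (0 : ℝ) < (A : ℝ) - 1 := sub_pos.2 (by exact_mod_cast hA)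
  have hA0 : (0 : ℝ) < A := by linarith
  have hb' : (0 : ℝ) < b := by exact_mod_cast hb
  have hc' : (0 : ℝ) < c := by exact_mod_cast hc
  have hcb' : (c : ℝ) ≤ b := by exact_mod_cast hcb
  have hbc' : (b : ℝ) * (A - 1) ≤ c * A := by exact_mod_cast hbc
  have hR : A / ((A : ℝ) - 1) ≤ r := by rwa [div_le_iff₀ hA1]
  have hr0 : 0 < r := lt_of_lt_of_le (by positivity) hR
  have hbr : (b : ℝ) ≤ c * r := by
    refine le_trans ?_ (mul_le_mul_of_nonneg_left hR hc'.le)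
    rwa [← mul_div_assoc, le_div_iff₀ hA1]
  have hs0 : 0 ≤ s := le_trans (by positivity) hs
  rw [pow_add]
  refine add_le_add ?_ ?_
  · calc _ = A / ((A : ℝ) - 1) * (q ^ k * (q : ℝ) ^ padicValNat q k.factorial * k.centralBinom *
          (A : ℝ) ^ k) / (q * (b : ℝ) ^ (q - 1)) := by
          field_simp
          ring
      _ ≤ _ := by gcongr
  · have hq0 : 0 < (q : ℝ) - 1 := by linarith
    have h4 : q / (4 * ((A : ℝ) - 1)) ≤ q * r / (4 * A) := by
      rw [div_le_div_iff₀ (by positivity) (by positivity)]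
      nlinarith
    calc _ = (q - 1) / q * (A / ((A : ℝ) - 1)) * (q : ℝ) ^ padicValNat q k.factorial * b *
          (q / (4 * ((A : ℝ) - 1))) ^ k := by
          rw [div_pow]
          field_simp
      _ ≤ (q - 1) / q * r * s * (c * r) * (q * r / (4 * A)) ^ k := by gcongr
      _ = _ := by ring

theorem pow_padicValNat_factorial_le {q k : ℕ} (hq : q.Prime) (hk : k ≠ 0) {c : ℝ} (hc : 1 ≤ c)
    (h : (q : ℝ) ≤ c ^ (q - 1)) : (q : ℝ) ^ padicValNat q k.factorial ≤ c ^ (k - 1) := by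
  have := Fact.mk hq
  have h1 := sub_one_mul_padicValNat_factorial_lt_of_ne_zero q hk
  calc (q : ℝ) ^ padicValNat q k.factorial ≤ (c ^ (q - 1)) ^ padicValNat q k.factorial := by gcongr
    _ = c ^ ((q - 1) * padicValNat q k.factorial) := by rw [pow_mul]
    _ ≤ c ^ (k - 1) := pow_le_pow_right₀ hc (by omega)

theorem centralBinom_add_one_le (k : ℕ) : (k + 1).centralBinom ≤ 2 * 4 ^ k := by
  induction k with
  | zero => simp [Nat.centralBinom, Nat.choose]
  | succ k ih =>
    have := Nat.succ_mul_centralBinom_succ (k + 1)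
    rw [pow_succ]
    nlinarith

theorem centralBinom_add_two_le (k : ℕ) : (k + 2).centralBinom ≤ 6 * 4 ^ k := by
  induction k with
  | zero => decide
  | succ k ih =>
    have := Nat.succ_mul_centralBinom_succ (k + 2)
    rw [pow_succ]
    nlinarith

theorem pow_mul_pow_sub_one_ne_of_five_le {q : ℕ} (hq : q.Prime) (hq5 : 5 ≤ q) {a b : ℤ} {N : ℕ}
    (ha : 2 ≤ a) (hb : 0 < b) (hN : 2 ≤ N) : a ^ q * (a ^ N) ^ q - 1 ≠ (a ^ q - 1) * b ^ q := by
  intro h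
  obtain ⟨n, rfl⟩ : ∃ n, q = n + 5 := ⟨q - 5, by omega⟩
  have ha' : (2 : ℝ) ≤ a := by exact_mod_cast ha
  have hA : 1 < a ^ (n + 5) := one_lt_pow₀ (by omega) (by omega)
  have hr : ((a ^ (n + 5) : ℤ) : ℝ) ≤ 32 / 31 * ((a ^ (n + 5) : ℤ) - 1) := by
    have : (32 : ℝ) ≤ ((a ^ (n + 5) : ℤ) : ℝ) := by
      push_cast
      calc (32 : ℝ) = 2 ^ 5 := by norm_num
        _ ≤ (a : ℝ) ^ 5 := by gcongr
        _ ≤ _ := pow_le_pow_right₀ (by linarith) (by omega)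
    linarith
  have hn : (0 : ℝ) ≤ n := by positivity
  have hn2 : (n : ℝ) + 1 ≤ 2 ^ n := by exact_mod_cast Nat.lt_two_pow_self
  have ha2 : (2 : ℝ) ^ n ≤ (a : ℝ) ^ n := by gcongr
  obtain ⟨k, hk1, hk2⟩ : ∃ k, 3 * k + 1 ≤ N ∧ N ≤ 3 * k + 3 := ⟨(N - 1) / 3, by omega, by omega⟩
  have hc : (((n + 5 : ℕ) : ℕ) : ℝ) ≤ (3 / 2 : ℝ) ^ (n + 5 - 1) := by
    have := one_add_mul_le_pow (a := (1 / 2 : ℝ)) (by norm_num) n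
    rw [show n + 5 - 1 = n + 4 by omega, pow_add]
    norm_num at this ⊢
    nlinarith
  have key := one_le_of_mul_pow_sub_one_eq' hq hA hb (by positivity) h (k + 1) hr
    (pow_padicValNat_factorial_le hq (by omega) (by norm_num) hc)
  push_cast at key
  have hbase : (n + 5) / (a : ℝ) ^ (n + 2) ≤ 5 / 4 := by
    rw [div_le_iff₀ (by positivity), pow_add]
    nlinarith [mul_le_mul ha2 (mul_le_mul ha' ha' (by norm_num) (by positivity)) (by positivity)
      (by positivity)]
  have hT2 : ((n : ℝ) + 5 - 1) / (n + 5) * (32 / 31) ^ 2 * (3 / 2) ^ k * a ^ N *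
      ((n + 5) * (32 / 31) / (4 * (a : ℝ) ^ (n + 5))) ^ (k + 1) ≤
      (32 / 31) ^ 2 * (2 / 3) * (15 / 31) ^ (k + 1) := by
    have e1 : ((n : ℝ) + 5 - 1) / (n + 5) ≤ 1 := by
      rw [div_le_one (by positivity)]; linarith
    have e2 : (a : ℝ) ^ N ≤ ((a : ℝ) ^ 3) ^ (k + 1) := by
      rw [← pow_mul]
      exact pow_le_pow_right₀ (by linarith) (by omega)
    calc _ ≤ 1 * (32 / 31) ^ 2 * (3 / 2) ^ k * ((a : ℝ) ^ 3) ^ (k + 1) *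
      ((n + 5) * (32 / 31) / (4 * (a : ℝ) ^ (n + 5))) ^ (k + 1) := by gcongr
      _ = (32 / 31) ^ 2 * (2 / 3) * ((12 / 31) * ((n + 5) / (a : ℝ) ^ (n + 2))) ^ (k + 1) := by
        rw [mul_assoc, ← mul_pow, mul_assoc]
        have : (3 / 2 : ℝ) ^ k = 2 / 3 * (3 / 2) ^ (k + 1) := by
          rw [pow_succ]; ring
        rw [this, mul_assoc (2 / 3 : ℝ), ← mul_pow, one_mul, ← mul_assoc]
        congr 2
        rw [show n + 5 = n + 2 + 3 by omega, pow_add]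
        field_simp
        ring
      _ ≤ (32 / 31) ^ 2 * (2 / 3) * ((12 / 31) * (5 / 4)) ^ (k + 1) := by gcongr
      _ = _ := by norm_num
  rcases Nat.eq_zero_or_pos k with rfl | hk
  · have hT1 : (32 / 31 : ℝ) * ((n + 5) ^ (0 + 1) * (3 / 2) ^ 0 * (0 + 1).centralBinom *
        ((a : ℝ) ^ (n + 5)) ^ (0 + 1)) / ((n + 5) * (a ^ N) ^ (n + 4)) ≤ 8 / 31 := by
      rw [div_le_iff₀ (by positivity)]
      have e : (8 : ℝ) * (a : ℝ) ^ (n + 5) ≤ (a ^ N) ^ (n + 4) := by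
        calc (8 : ℝ) * (a : ℝ) ^ (n + 5) ≤ (a : ℝ) ^ 3 * (a : ℝ) ^ (n + 5) := by
              gcongr
              calc (8 : ℝ) = 2 ^ 3 := by norm_num
                _ ≤ _ := by gcongr
          _ ≤ _ := by
            rw [← pow_add, ← pow_mul]
            refine pow_le_pow_right₀ (by linarith) ?_
            nlinarith
      have e3 : (0 + 1).centralBinom = 2 := by decide
      rw [e3]
      have := mul_le_mul_of_nonneg_left e (by linarith : (0 : ℝ) ≤ n + 5)
      norm_num
      linarith
    norm_num at hT1 hT2 key
    linarith
  · obtain ⟨j, rfl⟩ : ∃ j, k = j + 1 := ⟨k - 1, by omega⟩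
    have hT1 : (32 / 31 : ℝ) * ((n + 5) ^ (j + 1 + 1) * (3 / 2) ^ (j + 1) *
        (j + 1 + 1).centralBinom * ((a : ℝ) ^ (n + 5)) ^ (j + 1 + 1)) /
        ((n + 5) * (a ^ N) ^ (n + 4)) ≤ 32 / 31 * (45 / 64) := by
      rw [div_le_iff₀ (by positivity)]
      have e1 : ((j + 1 + 1).centralBinom : ℝ) ≤ 6 * 4 ^ j := by
        exact_mod_cast centralBinom_add_two_le j
      have e2 : (a : ℝ) ^ ((2 * n + 7) * j + (2 * n + 6)) * ((a : ℝ) ^ (n + 5)) ^ (j + 1 + 1) ≤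
          (a ^ N) ^ (n + 4) := by
        rw [← pow_mul, ← pow_add, ← pow_mul]
        refine pow_le_pow_right₀ (by linarith) ?_
        nlinarith
      have h4 : (1 + 3 * n : ℝ) ≤ 4 ^ n := by
        have := one_add_mul_le_pow (a := (3 : ℝ)) (by norm_num) n
        norm_num at this
        linarith
      have h5 : (4 : ℝ) ^ n ≤ a ^ (2 * n) := by
        rw [show (4 : ℝ) = 2 ^ 2 by norm_num, ← pow_mul]; gcongr
      have e3 : (64 : ℝ) * (n + 5) ≤ 5 * (a : ℝ) ^ (2 * n + 6) := by
        rw [pow_add]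
        have : (2 : ℝ) ^ 6 ≤ (a : ℝ) ^ 6 := by gcongr
        nlinarith [mul_le_mul h5 this (by positivity) (by positivity)]
      have e4 : (6 : ℝ) * (n + 5) ≤ (a : ℝ) ^ (2 * n + 7) := by
        rw [pow_add]
        have : (2 : ℝ) ^ 7 ≤ (a : ℝ) ^ 7 := by gcongr
        nlinarith [mul_le_mul h5 this (by positivity) (by positivity)]
      have e5 : ((6 : ℝ) * (n + 5)) ^ j * (64 * (n + 5)) ≤
          5 * (a : ℝ) ^ ((2 * n + 7) * j + (2 * n + 6)) := by
        calc _ ≤ ((a : ℝ) ^ (2 * n + 7)) ^ j * (5 * (a : ℝ) ^ (2 * n + 6)) := by gcongr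
          _ = _ := by rw [pow_add, pow_mul]; ring
      have hX : (0 : ℝ) < ((a : ℝ) ^ (n + 5)) ^ (j + 1 + 1) := by positivity
      calc _ ≤ (32 / 31 : ℝ) * ((n + 5) ^ (j + 1 + 1) * (3 / 2) ^ (j + 1) *
            (6 * 4 ^ j) * ((a : ℝ) ^ (n + 5)) ^ (j + 1 + 1)) := by gcongr
        _ = (32 / 31 : ℝ) * (9 / 64) * (n + 5) * ((((6 : ℝ) * (n + 5)) ^ j * (64 * (n + 5))) *
            ((a : ℝ) ^ (n + 5)) ^ (j + 1 + 1)) := by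
          have : (6 : ℝ) ^ j = (3 / 2) ^ j * 4 ^ j := by rw [← mul_pow]; norm_num
          rw [mul_pow 6, this]
          ring
        _ ≤ (32 / 31 : ℝ) * (9 / 64) * (n + 5) * ((5 * (a : ℝ) ^ ((2 * n + 7) * j + (2 * n + 6))) *
            ((a : ℝ) ^ (n + 5)) ^ (j + 1 + 1)) := by gcongr
        _ = (32 / 31 : ℝ) * (45 / 64) * (n + 5) * ((a : ℝ) ^ ((2 * n + 7) * j + (2 * n + 6)) *
            ((a : ℝ) ^ (n + 5)) ^ (j + 1 + 1)) := by ring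
        _ ≤ (32 / 31 : ℝ) * (45 / 64) * (n + 5) * (a ^ N) ^ (n + 4) := by gcongr
        _ = _ := by ring
    have e6 : (15 / 31 : ℝ) ^ (j + 1 + 1) ≤ (15 / 31) ^ 2 :=
      pow_le_pow_of_le_one (by norm_num) (by norm_num) (by omega)
    have : (32 / 31 : ℝ) ^ 2 * (2 / 3) * (15 / 31) ^ (j + 1 + 1) ≤
      (32 / 31) ^ 2 * (2 / 3) * (15 / 31) ^ 2 := by gcongr
    norm_num at this
    linarith

theorem one_le_of_cube_mul_cube_sub_one_eq {a b : ℤ} {N k e f : ℕ} (ha : 5 ≤ a) (hb : 0 < b)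
    (h : a ^ 3 * (a ^ N) ^ 3 - 1 = (a ^ 3 - 1) * b ^ 3) (he : 3 * (k + 1) + e = 2 * N)
    (hf : N + f = 3 * (k + 1)) {s B : ℝ}
    (hs : (3 : ℝ) ^ padicValNat 3 (k + 1).factorial ≤ s) (hB : ((k + 1).centralBinom : ℝ) ≤ B) :
    (1 : ℝ) ≤ 125 / 124 * (3 ^ k * s * B) / 5 ^ e +
      2 / 3 * (125 / 124) ^ 2 * s * (375 / 496) ^ (k + 1) / 5 ^ f := by
  have ha' : (5 : ℝ) ≤ a := by exact_mod_cast ha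
  have hA : 1 < a ^ 3 := one_lt_pow₀ (by omega) (by omega)
  have hr : ((a ^ 3 : ℤ) : ℝ) ≤ 125 / 124 * ((a ^ 3 : ℤ) - 1) := by
    have : (125 : ℝ) ≤ ((a ^ 3 : ℤ) : ℝ) := by
      push_cast
      calc (125 : ℝ) = 5 ^ 3 := by norm_num
        _ ≤ (a : ℝ) ^ 3 := by gcongr
    linarith
  have key := one_le_of_mul_pow_sub_one_eq' Nat.prime_three hA hb (by positivity) h (k + 1) hr hs
  have hs0 : 0 ≤ s := le_trans (by positivity) hs
  refine key.trans (add_le_add ?_ ?_)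
  · push_cast
    calc _ ≤ 125 / 124 * (3 ^ (k + 1) * s * B * ((a : ℝ) ^ 3) ^ (k + 1)) /
          (3 * ((a : ℝ) ^ N) ^ (3 - 1)) := by gcongr
      _ = 125 / 124 * (3 ^ k * s * B) / (a : ℝ) ^ e := by
        rw [← pow_mul, ← pow_mul, show N * (3 - 1) = 3 * (k + 1) + e by omega, pow_add _ _ e]
        field_simp
        ring
      _ ≤ _ := by
        have : 0 ≤ B := le_trans (by positivity) hB
        gcongr
  · push_cast
    calc _ = 2 / 3 * (125 / 124) ^ 2 * s * (375 / 496) ^ (k + 1) / (a : ℝ) ^ f := by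
          have h1 : ((a : ℝ) ^ 3) ^ (k + 1) = a ^ N * a ^ f := by rw [← pow_mul, ← pow_add, hf]
          have h2 : (3 * (125 / 124) / (4 * (a : ℝ) ^ 3)) ^ (k + 1) =
              (375 / 496) ^ (k + 1) / (a ^ N * a ^ f) := by
            rw [← h1, ← div_pow]
            congr 1
            field_simp
            norm_num
          rw [h2]
          field_simp
          ring
      _ ≤ _ := by gcongr

theorem one_le_of_cube_mul_cube_sub_one_eq' {a b : ℤ} {N : ℕ} (k e f : ℕ) (ha : 5 ≤ a) (hb : 0 < b)
    (h : a ^ 3 * (a ^ N) ^ 3 - 1 = (a ^ 3 - 1) * b ^ 3) (he : 3 * (k + 1) + e = 2 * N)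
    (hf : N + f = 3 * (k + 1)) :
    (1 : ℝ) ≤ 125 / 62 * (21 ^ k / 5 ^ e) +
      15625 / 40362 * ((2625 / 1984) ^ (k + 1) / 5 ^ f) := by
  refine (one_le_of_cube_mul_cube_sub_one_eq (B := 2 * 4 ^ k) ha hb h he hf
    (pow_padicValNat_factorial_le Nat.prime_three k.succ_ne_zero (c := 7 / 4) (by norm_num)
      (by norm_num)) (by exact_mod_cast centralBinom_add_one_le k)).trans_eq ?_
  have h1 : (21 : ℝ) ^ k = 3 ^ k * (7 / 4) ^ k * 4 ^ k := by
    rw [← mul_pow, ← mul_pow]; norm_num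
  have h2 : (2625 / 1984 : ℝ) ^ (k + 1) = 7 / 4 * ((7 / 4) ^ k * (375 / 496) ^ (k + 1)) := by
    rw [← mul_assoc, ← pow_succ', ← mul_pow]; norm_num
  rw [Nat.succ_sub_one, h1, h2]
  ring

theorem pow_mul_add_div_pow_le {x y : ℝ} {m n : ℕ} (hx : 0 < x) (hy : 0 < y) (h : x ^ m ≤ y ^ n)
    (j u v : ℕ) : x ^ (m * j + u) / y ^ (n * j + v) ≤ x ^ u / y ^ v := by
  rw [div_le_div_iff₀ (by positivity) (by positivity), pow_add, pow_add, pow_mul, pow_mul]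
  have : (x ^ m) ^ j ≤ (y ^ n) ^ j := by gcongr
  calc (x ^ m) ^ j * x ^ u * y ^ v ≤ (y ^ n) ^ j * x ^ u * y ^ v := by gcongr
    _ = _ := by ring

theorem cube_mul_cube_sub_one_ne {a b : ℤ} {N : ℕ} (ha : 5 ≤ a) (hb : 0 < b) (hN : 2 ≤ N) :
    a ^ 3 * (a ^ N) ^ 3 - 1 ≠ (a ^ 3 - 1) * b ^ 3 := by
  intro h
  have key : ∀ c r j e f, N = 8 * j + r → 3 * (c + 1) + e = 2 * r → r + f = 3 * (c + 1) →
      (1 : ℝ) ≤ 125 / 62 * (21 ^ c / 5 ^ e) + 15625 / 40362 * ((2625 / 1984) ^ (c + 1) / 5 ^ f) := by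
    intro c r j e f hr he hf
    refine (one_le_of_cube_mul_cube_sub_one_eq' (3 * j + c) (7 * j + e) (1 * j + f) ha hb h
      (by omega) (by omega)).trans ?_
    have h1 := pow_mul_add_div_pow_le (x := 21) (y := 5) (m := 3) (n := 7) (by norm_num)
      (by norm_num) (by norm_num) j c e
    have h2 := pow_mul_add_div_pow_le (x := 2625 / 1984) (y := 5) (m := 3) (n := 1) (by norm_num)
      (by norm_num) (by norm_num) j (c + 1) f
    rw [← add_assoc] at h2
    linarith
  have hcases : N = 4 ∨ ∃ j, N = 8 * j + 2 ∨ N = 8 * j + 3 ∨ N = 8 * j + 12 ∨ N = 8 * j + 5 ∨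
      N = 8 * j + 6 ∨ N = 8 * j + 7 ∨ N = 8 * j + 8 ∨ N = 8 * j + 9 := by
    rcases (by omega : N % 8 = 0 ∨ N % 8 = 1 ∨ N % 8 = 2 ∨ N % 8 = 3 ∨ N % 8 = 4 ∨ N % 8 = 5 ∨
      N % 8 = 6 ∨ N % 8 = 7) with h | h | h | h | h | h | h | h
    · exact Or.inr ⟨N / 8 - 1, by omega⟩
    · exact Or.inr ⟨N / 8 - 1, by omega⟩
    · exact Or.inr ⟨N / 8, by omega⟩
    · exact Or.inr ⟨N / 8, by omega⟩
    · by_cases h4 : N = 4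
      · exact Or.inl h4
      · exact Or.inr ⟨N / 8 - 1, by omega⟩
    · exact Or.inr ⟨N / 8, by omega⟩
    · exact Or.inr ⟨N / 8, by omega⟩
    · exact Or.inr ⟨N / 8, by omega⟩
  obtain hN4 | ⟨j, hj | hj | hj | hj | hj | hj | hj | hj⟩ := hcases
  · have := one_le_of_cube_mul_cube_sub_one_eq (k := 1) (e := 2) (f := 2) (s := 1) (B := 6) ha hb h
      (by omega) (by omega) (by rw [padicValNat.eq_zero_of_not_dvd (by decide), pow_zero])
      (by exact_mod_cast centralBinom_add_two_le 0)
    norm_num at this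
  · have := key 0 2 j 1 1 hj rfl rfl
    norm_num at this
  · have := key 0 3 j 3 0 hj rfl rfl
    norm_num at this
  · have := key 4 12 j 9 3 hj rfl rfl
    norm_num at this
  · have := key 1 5 j 4 1 hj rfl rfl
    norm_num at this
  · have := key 1 6 j 6 0 hj rfl rfl
    norm_num at this
  · have := key 2 7 j 5 2 hj rfl rfl
    norm_num at this
  · have := key 2 8 j 7 1 hj rfl rfl
    norm_num at this
  · have := key 2 9 j 9 0 hj rfl rfl
    norm_num at this

theorem eq_one_of_odd_of_dvd_two_pow {x : ℤ} {n : ℕ} (hx : Odd x) (hx0 : 0 ≤ x) (h : x ∣ 2 ^ n) :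
    x = 1 := by
  have h1 : IsCoprime x (2 ^ n) := (Int.isCoprime_two_right.2 hx).pow_right
  have := Int.isUnit_iff.1 (h1.isUnit_of_dvd' dvd_rfl h)
  omega

theorem two_pow_sub_one_ne_cube {n : ℕ} (hn : 2 ≤ n) (c : ℤ) : (2 : ℤ) ^ n - 1 ≠ c ^ 3 := by
  intro h
  have h1 : c ^ 2 - c + 1 = 1 := by
    refine eq_one_of_odd_of_dvd_two_pow (n := n) ?_ (by nlinarith [sq_nonneg (c - 1), sq_nonneg c])
      ⟨c + 1, by linear_combination h⟩
    have := Int.even_mul_succ_self (c - 1)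
    rw [show c ^ 2 - c + 1 = (c - 1) * (c - 1 + 1) + 1 by ring]
    exact this.add_one
  have h2 : c * (c - 1) = 0 := by linear_combination h1
  have h3 : (2 : ℤ) ^ 2 ≤ 2 ^ n := pow_le_pow_right₀ (by norm_num) hn
  rcases mul_eq_zero.1 h2 with h0 | h0
  · rw [h0] at h
    norm_num at h h3
    linarith
  · rw [show c = 1 by omega] at h
    norm_num at h h3
    linarith

theorem two_pow_add_one_ne_cube (n : ℕ) (c : ℤ) : (2 : ℤ) ^ n + 1 ≠ c ^ 3 := by
  intro h
  have h1 : c ^ 2 + c + 1 = 1 := by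
    refine eq_one_of_odd_of_dvd_two_pow (n := n) ?_ (by nlinarith [sq_nonneg (c + 1), sq_nonneg c])
      ⟨c - 1, by linear_combination h⟩
    have := Int.even_mul_succ_self c
    rw [show c ^ 2 + c + 1 = c * (c + 1) + 1 by ring]
    exact this.add_one
  have h2 : c * (c + 1) = 0 := by linear_combination h1
  have h3 : (0 : ℤ) < 2 ^ n := by positivity
  rcases mul_eq_zero.1 h2 with h0 | h0
  · rw [h0] at h
    norm_num at h
    linarith
  · rw [show c = -1 by omega] at h
    norm_num at h
    linarith

theorem exists_cube_of_mul_eq_nine_mul_cube {x y c : ℤ} (hxy : IsCoprime x y)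
    (h : x * y = 9 * c ^ 3) : (∃ d e, x = 9 * d ^ 3 ∧ y = e ^ 3) ∨
      ∃ d e, x = d ^ 3 ∧ y = 9 * e ^ 3 := by
  have main : ∀ x y : ℤ, IsCoprime x y → x * y = 9 * c ^ 3 → 3 ∣ x →
      ∃ d e, x = 9 * d ^ 3 ∧ y = e ^ 3 := by
    intro x y hxy h hx
    have h3 : IsCoprime (9 : ℤ) y := by
      have : IsCoprime (3 : ℤ) y := hxy.of_isCoprime_of_dvd_left hx
      exact this.pow_left (m := 2)
    obtain ⟨z, rfl⟩ := h3.dvd_of_dvd_mul_right (⟨c ^ 3, h⟩ : (9 : ℤ) ∣ x * y)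
    have hzy : IsCoprime z y := hxy.of_isCoprime_of_dvd_left (Dvd.intro_left _ rfl)
    have hz : z * y = c ^ 3 := by linarith
    obtain ⟨d, hd⟩ := Int.eq_pow_of_mul_eq_pow_odd_left hzy (by decide : Odd 3) hz
    obtain ⟨e, he⟩ := Int.eq_pow_of_mul_eq_pow_odd_right hzy (by decide : Odd 3) hz
    exact ⟨d, e, by rw [hd], he⟩
  have hdvd : (3 : ℤ) ∣ x * y := ⟨3 * c ^ 3, by rw [h]; ring⟩
  rcases Int.prime_three.dvd_or_dvd hdvd with h3 | h3
  · exact Or.inl (main x y hxy h h3)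
  · obtain ⟨d, e, hd, he⟩ := main y x hxy.symm (by rw [mul_comm, h]) h3
    exact Or.inr ⟨e, d, he, hd⟩

theorem pow_six_add_pow_three_add_one_ne_cube {y : ℤ} (hy : 0 < y) (e : ℤ) :
    y ^ 6 + y ^ 3 + 1 ≠ e ^ 3 := by
  intro h
  have h1 : y ^ 2 < e := by
    refine lt_of_pow_lt_pow_left₀ 3 ?_ ?_
    · by_contra! he
      have : e ^ 3 < 0 := Odd.pow_neg (by decide) he
      have : 0 < y ^ 6 + y ^ 3 + 1 := by positivity
      omega
    · rw [← h]
      have : 0 < y ^ 3 := by positivity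
      nlinarith
  have h2 : e < y ^ 2 + 1 := by
    refine lt_of_pow_lt_pow_left₀ 3 (by positivity) ?_
    rw [← h]
    have : 0 < y ^ 2 := by positivity
    have : y ^ 3 * 1 ≤ y ^ 3 * y := by gcongr; omega
    nlinarith
  omega

theorem isCoprime_sub_one_add_one {x : ℤ} (hx : Even x) : IsCoprime (x - 1) (x + 1) := by
  obtain ⟨y, rfl⟩ := hx
  exact ⟨-y - 1, y, by ring⟩

theorem exists_eight_pow_sub_one_eq {s : ℕ} (hs : s ≠ 0) {c : ℤ} (h : (64 : ℤ) ^ s - 1 = 63 * c ^ 3) :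
    ∃ w : ℤ, (8 : ℤ) ^ s - 1 = 7 * w ^ 3 := by
  obtain ⟨p, hp⟩ : (7 : ℤ) ∣ 8 ^ s - 1 := by simpa using sub_dvd_pow_sub_pow (8 : ℤ) 1 s
  have h64 : (64 : ℤ) ^ s = 8 ^ s * 8 ^ s := by rw [← mul_pow]; norm_num
  have hc : IsCoprime ((8 : ℤ) ^ s - 1) (8 ^ s + 1) :=
    isCoprime_sub_one_add_one ((by decide : Even (8 : ℤ)).pow_of_ne_zero hs)
  have h8 : (8 : ℤ) ^ s = 2 ^ (3 * s) := by rw [pow_mul]; norm_num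
  rcases exists_cube_of_mul_eq_nine_mul_cube (x := p) (c := c)
    (hc.of_isCoprime_of_dvd_left ⟨7, by rw [hp, mul_comm]⟩)
    (by apply mul_left_cancel₀ (by norm_num : (7 : ℤ) ≠ 0)
        rw [← mul_assoc, ← hp]
        linear_combination h - h64) with ⟨d, e, -, he⟩ | ⟨d, e, hd, -⟩
  · rw [h8] at he
    exact absurd he (two_pow_add_one_ne_cube _ _)
  · exact ⟨d, by rw [hp, hd]⟩

theorem eight_pow_sub_one_ne {n : ℕ} (hn : 2 ≤ n) (b : ℤ) : (8 : ℤ) ^ n - 1 ≠ 7 * b ^ 3 := by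
  induction n using Nat.strong_induction_on generalizing b with
  | _ n ih =>
  intro h
  set X : ℤ := 2 ^ n with hX
  have hX3 : (8 : ℤ) ^ n = X ^ 3 := by rw [hX, ← pow_mul, mul_comm, pow_mul]; norm_num
  rw [hX3] at h
  have h8 : ∀ s : ℕ, ∃ p : ℤ, (8 : ℤ) ^ s = 7 * p + 1 := fun s => by
    obtain ⟨p, hp⟩ : (7 : ℤ) ∣ 8 ^ s - 1 := by simpa using sub_dvd_pow_sub_pow (8 : ℤ) 1 s
    exact ⟨p, by linarith⟩
  have hcop : ¬ (3 : ℤ) ∣ X - 1 → IsCoprime (X - 1) (X ^ 2 + X + 1) := fun h3 => by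
    have h1 : IsCoprime (X - 1) 3 := ((Int.prime_three.coprime_iff_not_dvd).2 h3).symm
    rw [show X ^ 2 + X + 1 = 3 + (X - 1) * (X + 2) by ring]
    exact h1.add_mul_left_right (X + 2)
  have heven : (3 : ℤ) ∣ X - 1 → ∃ s, n = 2 * s := fun h3 => by
    rcases Nat.even_or_odd' n with ⟨s, hs | hs⟩
    · exact ⟨s, hs⟩
    · obtain ⟨p, hp⟩ : (3 : ℤ) ∣ 4 ^ s - 1 := by simpa using sub_dvd_pow_sub_pow (4 : ℤ) 1 s
      rw [hX, hs, pow_succ, pow_mul] at h3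
      norm_num at h3
      omega
  have hcop' : ∀ u, X - 1 = 3 * u → IsCoprime (X - 1) (3 * u ^ 2 + 3 * u + 1) := fun u hu => by
    rw [hu]
    exact ⟨-(u + 1), 1, by ring⟩
  have hcube : ∀ p m u : ℤ, IsCoprime p m → m ∣ 3 * u ^ 2 + 3 * u + 1 → 3 * (p * m) = b ^ 3 →
      ∃ d, p = 9 * d ^ 3 := by
    intro p m u hpm hm hb
    obtain ⟨b', rfl⟩ := Int.prime_three.dvd_of_dvd_pow (Dvd.intro _ hb)
    rcases exists_cube_of_mul_eq_nine_mul_cube (c := b') hpm (by linarith) with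
      ⟨d, e, hd, -⟩ | ⟨d, e, -, he⟩
    · exact ⟨d, hd⟩
    · have : (3 : ℤ) ∣ 3 * u ^ 2 + 3 * u + 1 := (Dvd.intro (3 * e ^ 3) (by rw [he]; ring)).trans hm
      omega
  have hr := Nat.div_add_mod n 3
  set r := n / 3
  obtain ⟨p, hp⟩ := h8 r
  by_cases hi : n % 3 = 0
  · have hXr : X = 8 ^ r := by rw [hX, ← hr, hi, add_zero, pow_mul]; norm_num
    have hX6 : X ^ 2 + X + 1 = (2 ^ r) ^ 6 + (2 ^ r) ^ 3 + 1 := by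
      have : X = (2 ^ r) ^ 3 := by rw [hXr, ← pow_mul, mul_comm, pow_mul]; norm_num
      rw [this]; ring
    have hpX : X - 1 = 7 * p := by rw [hXr, hp]; ring
    have hb : p * (X ^ 2 + X + 1) = b ^ 3 := by
      apply mul_left_cancel₀ (by norm_num : (7 : ℤ) ≠ 0)
      rw [← mul_assoc, ← hpX, ← h]; ring
    have hpd : p ∣ X - 1 := ⟨7, by rw [hpX, mul_comm]⟩
    by_cases h3 : (3 : ℤ) ∣ X - 1
    · obtain ⟨s, hs⟩ := heven h3
      obtain ⟨u, hu⟩ := h3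
      obtain ⟨d, hd⟩ := hcube p _ u ((hcop' u hu).of_isCoprime_of_dvd_left hpd) dvd_rfl
        (by rw [← hb, show X = 3 * u + 1 by linarith]; ring)
      obtain ⟨t, ht⟩ : ∃ t, n = 6 * t := ⟨n / 6, by omega⟩
      have h64 : X = 64 ^ t := by rw [hX, ht, pow_mul]; norm_num
      obtain ⟨w, hw⟩ := exists_eight_pow_sub_one_eq (s := t) (c := d) (by omega)
        (by rw [← h64, hpX, hd]; ring)
      by_cases ht1 : t = 1
      · have hb' : b ^ 3 = 37449 := by
          rw [h64, ht1] at h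
          linarith
        have := congrArg (Int.cast : ℤ → ZMod 13) hb'
        push_cast at this
        generalize (b : ZMod 13) = z at this
        revert z
        decide
      · exact ih t (by omega) (by omega) w hw
    · obtain ⟨e, he⟩ := Int.eq_pow_of_mul_eq_pow_odd_right
        ((hcop h3).of_isCoprime_of_dvd_left hpd) (by decide : Odd 3) hb
      rw [hX6] at he
      exact pow_six_add_pow_three_add_one_ne_cube (by positivity) e he
  · obtain ⟨t, ht⟩ : (7 : ℤ) ∣ X ^ 2 + X + 1 := by
      have : X = 8 ^ r * 2 ^ (n % 3) := by
        rw [hX]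
        nth_rewrite 1 [← hr]
        rw [pow_add, pow_mul]
        norm_num
      rw [this, hp]
      rcases (by omega : n % 3 = 1 ∨ n % 3 = 2) with h1 | h1
      · rw [h1]
        exact ⟨28 * p ^ 2 + 10 * p + 1, by ring⟩
      · rw [h1]
        exact ⟨112 * p ^ 2 + 36 * p + 3, by ring⟩
    have hb : (X - 1) * t = b ^ 3 := by
      apply mul_left_cancel₀ (by norm_num : (7 : ℤ) ≠ 0)
      rw [← h, mul_left_comm, ← ht]; ring
    by_cases h3 : (3 : ℤ) ∣ X - 1
    · obtain ⟨s, hs⟩ := heven h3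
      obtain ⟨u, hu⟩ := h3
      have h3m : 7 * t = 3 * (3 * u ^ 2 + 3 * u + 1) := by
        rw [← ht, show X = 3 * u + 1 by linarith]; ring
      obtain ⟨m, hm⟩ : (3 : ℤ) ∣ t := by omega
      have hmd : m ∣ 3 * u ^ 2 + 3 * u + 1 := ⟨7, by linarith⟩
      obtain ⟨d, hd⟩ := hcube (X - 1) m u ((hcop' u hu).of_isCoprime_of_dvd_right hmd) hmd
        (by rw [← hb, hm]; ring)
      have hs1 : s ≠ 1 := by
        rintro rfl
        rw [hX, hs] at hd
        norm_num at hd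
        omega
      have hXs : X = 2 ^ s * 2 ^ s := by rw [hX, hs, two_mul, pow_add]
      rcases exists_cube_of_mul_eq_nine_mul_cube (c := d) (isCoprime_sub_one_add_one
          ((by decide : Even (2 : ℤ)).pow_of_ne_zero (by omega : s ≠ 0)))
          (by rw [← hd, hXs]; ring) with ⟨_, e, -, he⟩ | ⟨e, _, he, -⟩
      · exact two_pow_add_one_ne_cube _ _ he
      · exact two_pow_sub_one_ne_cube (by omega) _ he
    · obtain ⟨e, he⟩ := Int.eq_pow_of_mul_eq_pow_odd_left
        ((hcop h3).of_isCoprime_of_dvd_right (Dvd.intro_left _ ht.symm)) (by decide : Odd 3) hb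
      exact two_pow_sub_one_ne_cube hn e he

theorem twentySeven_pow_sub_one_ne {n : ℕ} (hn : 2 ≤ n) (b : ℤ) :
    (27 : ℤ) ^ n - 1 ≠ 26 * b ^ 3 := by
  intro h
  set Z : ℤ := 3 ^ n with hZ
  have hZ3 : (27 : ℤ) ^ n = Z ^ 3 := by rw [hZ, ← pow_mul, mul_comm, pow_mul]; norm_num
  rw [hZ3] at h
  obtain ⟨z, hz⟩ : (9 : ℤ) ∣ Z := pow_dvd_pow (3 : ℤ) hn
  have hcop : IsCoprime (Z - 1) (Z ^ 2 + Z + 1) := by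
    rw [hz]
    exact ⟨-(27 * z ^ 2 + 6 * z + 1), 3 * z, by ring⟩
  have hr := Nat.div_add_mod n 3
  set r := n / 3
  obtain ⟨p, hp⟩ : (26 : ℤ) ∣ 27 ^ r - 1 := by simpa using sub_dvd_pow_sub_pow (27 : ℤ) 1 r
  by_cases hi : n % 3 = 0
  · have hZr : Z = 27 ^ r := by rw [hZ, ← hr, hi, add_zero, pow_mul]; norm_num
    have hZ6 : Z ^ 2 + Z + 1 = (3 ^ r) ^ 6 + (3 ^ r) ^ 3 + 1 := by
      have : Z = (3 ^ r) ^ 3 := by rw [hZr, ← pow_mul, mul_comm, pow_mul]; norm_num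
      rw [this]; ring
    have hb : p * (Z ^ 2 + Z + 1) = b ^ 3 := by
      apply mul_left_cancel₀ (by norm_num : (26 : ℤ) ≠ 0)
      rw [← mul_assoc, ← hp, ← h, ← hZr]; ring
    obtain ⟨e, he⟩ := Int.eq_pow_of_mul_eq_pow_odd_right
      (hcop.of_isCoprime_of_dvd_left (Dvd.intro_left _ (by rw [hZr, hp]))) (by decide : Odd 3) hb
    rw [hZ6] at he
    exact pow_six_add_pow_three_add_one_ne_cube (by positivity) e he
  · have hZr : Z = (26 * p + 1) * 3 ^ (n % 3) := by
      rw [hZ, ← hp]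
      nth_rewrite 1 [← hr]
      rw [pow_add, pow_mul]
      norm_num
    obtain ⟨t, ht⟩ : (13 : ℤ) ∣ Z ^ 2 + Z + 1 := by
      rw [hZr]
      rcases (by omega : n % 3 = 1 ∨ n % 3 = 2) with h1 | h1
      · rw [h1]
        exact ⟨468 * p ^ 2 + 42 * p + 1, by ring⟩
      · rw [h1]
        exact ⟨4212 * p ^ 2 + 342 * p + 7, by ring⟩
    obtain ⟨v, hv⟩ : (2 : ℤ) ∣ Z - 1 := by
      rw [hZ]; simpa using sub_dvd_pow_sub_pow (3 : ℤ) 1 n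
    have hb : v * t = b ^ 3 := by
      apply mul_left_cancel₀ (by norm_num : (26 : ℤ) ≠ 0)
      rw [← h]
      linear_combination (-13 * t) * hv - (Z - 1) * ht
    obtain ⟨e, he⟩ := Int.eq_pow_of_mul_eq_pow_odd_left
      ((hcop.of_isCoprime_of_dvd_left (Dvd.intro_left _ hv.symm)).of_isCoprime_of_dvd_right
        (Dvd.intro_left _ ht.symm)) (by decide : Odd 3) hb
    have h9 : 2 * e ^ 3 = 9 * z - 1 := by rw [← he, ← hv, hz]
    have := congrArg (Int.cast : ℤ → ZMod 9) h9
    push_cast at this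
    rw [show (9 : ZMod 9) = 0 from rfl, zero_mul] at this
    generalize (e : ZMod 9) = y at this
    revert y
    decide

theorem sixtyFour_pow_sub_one_ne {n : ℕ} (hn : 2 ≤ n) (b : ℤ) :
    (64 : ℤ) ^ n - 1 ≠ 63 * b ^ 3 := by
  intro h
  obtain ⟨w, hw⟩ := exists_eight_pow_sub_one_eq (by omega) h
  exact eight_pow_sub_one_ne hn w hw

theorem eval_chebyshev_T_add_two (y : ℤ) (m : ℕ) :
    (Chebyshev.T ℤ (m + 2 : ℕ)).eval y =
      2 * y * (Chebyshev.T ℤ (m + 1 : ℕ)).eval y - (Chebyshev.T ℤ m).eval y := by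
  push_cast
  rw [Chebyshev.T_add_two]
  simp

theorem xn_eq_eval_chebyshev_T {a : ℕ} (ha : 1 < a) (m : ℕ) :
    (Pell.xn ha m : ℤ) = (Chebyshev.T ℤ m).eval (a : ℤ) := by
  induction m using Nat.twoStepInduction with
  | zero => simp
  | one => simp
  | more m h0 h1 =>
    have := Pell.xn_succ_succ ha m
    rw [eval_chebyshev_T_add_two, ← h0, ← h1]
    zify at this
    linarith

theorem exists_eval_chebyshev_T_eq (y : ℤ) (j : ℕ) :
    (∃ w, (Chebyshev.T ℤ (2 * j : ℕ)).eval y = (-1) ^ j + y ^ 2 * w) ∧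
      ∃ w, (Chebyshev.T ℤ (2 * j + 1 : ℕ)).eval y = y * ((-1) ^ j * (2 * j + 1 : ℕ) + y ^ 2 * w) := by
  induction j with
  | zero => exact ⟨⟨0, by simp⟩, ⟨0, by simp⟩⟩
  | succ j ih =>
    obtain ⟨⟨u, hu⟩, ⟨v, hv⟩⟩ := ih
    have h1 : (Chebyshev.T ℤ (2 * (j + 1) : ℕ)).eval y = (-1) ^ (j + 1) +
        y ^ 2 * (2 * ((-1) ^ j * (2 * j + 1 : ℕ) + y ^ 2 * v) - u) := by
      rw [show 2 * (j + 1) = 2 * j + 2 by ring, eval_chebyshev_T_add_two, hu, hv]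
      ring
    refine ⟨⟨_, h1⟩, ⟨2 * (2 * ((-1) ^ j * (2 * j + 1 : ℕ) + y ^ 2 * v) - u) - v, ?_⟩⟩
    rw [show 2 * (j + 1) + 1 = (2 * j + 1) + 2 by ring, eval_chebyshev_T_add_two,
      show 2 * j + 1 + 1 = 2 * (j + 1) by ring, h1, hv]
    push_cast
    ring

theorem pow_le_eval_chebyshev_T {y : ℤ} (hy : 1 ≤ y) (m : ℕ) :
    y ^ m ≤ (Chebyshev.T ℤ m).eval y := by
  have key : ∀ m : ℕ, 0 < (Chebyshev.T ℤ m).eval y ∧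
      y * (Chebyshev.T ℤ m).eval y ≤ (Chebyshev.T ℤ (m + 1 : ℕ)).eval y := by
    intro m
    induction m with
    | zero => simp
    | succ m ih =>
      obtain ⟨h0, h1⟩ := ih
      refine ⟨by nlinarith, ?_⟩
      rw [eval_chebyshev_T_add_two]
      have h2 := mul_le_mul_of_nonneg_left h1 (by omega : 0 ≤ y)
      have h3 : 1 ≤ y * y := by nlinarith
      nlinarith
  induction m with
  | zero => simp
  | succ m ih =>
    rw [pow_succ, mul_comm]
    exact (mul_le_mul_of_nonneg_left ih (by omega)).trans (key m).2

theorem pow_ne_eval_chebyshev_T {a : ℤ} (ha : 2 ≤ a) {n : ℕ} (hn : 2 ≤ n) (k : ℕ) :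
    a ^ n ≠ (Chebyshev.T ℤ k).eval a := by
  intro h
  obtain ⟨n, rfl⟩ : ∃ m, n = m + 2 := ⟨n - 2, by omega⟩
  rcases Nat.even_or_odd' k with ⟨j, rfl | rfl⟩
  · obtain ⟨w, hw⟩ := (exists_eval_chebyshev_T_eq a j).1
    have h1 : a ∣ (-1) ^ j := ⟨a ^ (n + 1) - a * w, by linear_combination -hw - h⟩
    have := Int.isUnit_iff.1 (isUnit_of_dvd_unit h1 (isUnit_one.neg.pow j))
    omega
  · obtain ⟨w, hw⟩ := (exists_eval_chebyshev_T_eq a j).2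
    have hak : a ∣ (2 * j + 1 : ℕ) := by
      have h1 : a ∣ (-1) ^ j * (2 * j + 1 : ℕ) := by
        refine ⟨a ^ n - a * w, ?_⟩
        apply mul_left_cancel₀ (by omega : a ≠ 0)
        linear_combination -h - hw
      exact ((isUnit_one.neg.pow j : IsUnit ((-1 : ℤ) ^ j)).dvd_mul_left).1 h1
    lift a to ℕ using by omega
    obtain ⟨c, hc⟩ := Int.natCast_dvd_natCast.1 hak
    obtain ⟨hodd, hodd'⟩ := Nat.odd_mul.1 (hc ▸ odd_two_mul_add_one j)
    obtain ⟨i, rfl⟩ := hodd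
    obtain ⟨l, rfl⟩ := hodd'
    obtain ⟨z, hz⟩ := (exists_eval_chebyshev_T_eq ((2 * i + 1 : ℕ) : ℤ) l).2
    set y := (Chebyshev.T ℤ (2 * l + 1 : ℕ)).eval ((2 * i + 1 : ℕ) : ℤ) with hy
    have hcomp : (Chebyshev.T ℤ (2 * j + 1 : ℕ)).eval ((2 * i + 1 : ℕ) : ℤ) =
        (Chebyshev.T ℤ (2 * i + 1 : ℕ)).eval y := by
      rw [hc, Nat.cast_mul, Chebyshev.T_mul, eval_comp]
    rw [hcomp] at h
    obtain ⟨v, hv⟩ := (exists_eval_chebyshev_T_eq y i).2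
    set a : ℤ := ((2 * i + 1 : ℕ) : ℤ) with haa
    set t := (-1) ^ l * ((2 * l + 1 : ℕ) : ℤ) + a ^ 2 * z
    have hfac : a ^ (n + 2) = y * a * ((-1) ^ i + y * (t * v)) := by
      rw [h, hv]
      linear_combination y ^ 2 * v * hz
    have hcop : IsCoprime ((-1) ^ i + y * (t * v)) y :=
      IsCoprime.add_mul_left_left ⟨(-1) ^ i, 0, by simp [← mul_pow]⟩ _
    have hunit : IsUnit ((-1) ^ i + y * (t * v)) :=
      ((hcop.of_isCoprime_of_dvd_right ⟨t, hz⟩).pow_right (n := n + 2)).isUnit_of_dvd' dvd_rfl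
        (Dvd.intro_left _ hfac.symm)
    have hay : a ≤ y := by
      have h1 : a ^ 1 ≤ a ^ (2 * l + 1) := pow_le_pow_right₀ (by omega) (by omega)
      rw [pow_one] at h1
      exact h1.trans (pow_le_eval_chebyshev_T (by omega) _)
    have hle : a ^ (n + 2) ≤ y * a := by
      rw [hfac]
      have : 0 < y * a := by nlinarith
      rcases Int.isUnit_iff.1 hunit with h1 | h1 <;> rw [h1] <;> linarith
    have hge : y ^ 3 ≤ a ^ (n + 2) := by
      rw [h]
      exact (pow_le_pow_right₀ (by omega) (by omega)).trans (pow_le_eval_chebyshev_T (by omega) _)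
    nlinarith

theorem sq_mul_sq_sub_one_ne {a b : ℤ} {N : ℕ} (ha : 2 ≤ a) (hb : 0 < b) (hN : 1 ≤ N) :
    a ^ 2 * (a ^ N) ^ 2 - 1 ≠ (a ^ 2 - 1) * b ^ 2 := by
  intro h
  lift a to ℕ using by omega
  lift b to ℕ using by omega
  have ha1 : 1 < a := by omega
  obtain ⟨k, hk, -⟩ := Pell.eq_pell ha1 (x := a ^ (N + 1)) (y := b) (by
    rw [mul_assoc]
    change a ^ (N + 1) * a ^ (N + 1) - (a * a - 1) * (b * b) = 1
    have h1 : a ^ (N + 1) * a ^ (N + 1) = (a * a - 1) * (b * b) + 1 := by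
      zify [show 1 ≤ a * a by nlinarith]
      linear_combination h
    omega)
  refine pow_ne_eval_chebyshev_T ha (n := N + 1) (by omega) k ?_
  rw [← xn_eq_eval_chebyshev_T ha1, ← hk]
  push_cast
  rfl

theorem Int.exists_pos_eq_pow_of_mul_eq_pow {x y z : ℤ} {k : ℕ} (hk : k ≠ 0) (hx : 0 < x)
    (hxy : IsCoprime x y) (h : x * y = z ^ k) : ∃ d, 0 < d ∧ x = d ^ k := by
  obtain ⟨d, hd⟩ := exists_associated_pow_of_mul_eq_pow' hxy h
  rw [Int.associated_iff_natAbs, Int.natAbs_pow] at hd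
  refine ⟨d.natAbs, ?_, ?_⟩
  · rw [Int.natCast_pos, Nat.pos_iff_ne_zero]
    intro h0
    rw [h0, zero_pow hk] at hd
    omega
  · rw [← Int.natCast_pow, hd]
    omega

theorem pow_add_one_ne_pow {a b : ℤ} {q : ℕ} (hq : 2 ≤ q) (ha : 0 < a) (hb : 0 < b) :
    a ^ q + 1 ≠ b ^ q := by
  intro h
  have hab : a < b := lt_of_pow_lt_pow_left₀ q hb.le (by omega)
  have h1 : (a + 1) ^ q ≤ b ^ q := pow_le_pow_left₀ (by omega) hab q
  obtain ⟨n, rfl⟩ : ∃ n, q = n + 2 := ⟨q - 2, by omega⟩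
  have h2 : a ^ (n + 1) ≤ (a + 1) ^ (n + 1) := pow_le_pow_left₀ ha.le (by omega) _
  have h3 : 1 < (a + 1) ^ (n + 1) := one_lt_pow₀ (by omega) (by omega)
  have h4 : 0 < a ^ (n + 1) := by positivity
  rw [pow_succ a] at h
  rw [pow_succ (a + 1)] at h1
  nlinarith

theorem pow_mul_pow_sub_one_ne {q : ℕ} (hq : q.Prime) {a b : ℤ} {N : ℕ} (ha : 2 ≤ a) (hb : 0 < b)
    (hN : 1 ≤ N) : a ^ q * (a ^ N) ^ q - 1 ≠ (a ^ q - 1) * b ^ q := by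
  rcases eq_or_lt_of_le hN with rfl | hN2
  · intro h
    have hA : 1 < a ^ q := one_lt_pow₀ (by omega) hq.ne_zero
    refine pow_add_one_ne_pow hq.two_le (by omega : 0 < a) hb ?_
    apply mul_left_cancel₀ (by omega : a ^ q - 1 ≠ 0)
    rw [← h]
    ring
  by_cases hq5 : 5 ≤ q
  · exact pow_mul_pow_sub_one_ne_of_five_le hq hq5 ha hb hN2
  have hq4 : q ≠ 4 := by
    rintro rfl
    revert hq
    decide
  obtain rfl | rfl : q = 2 ∨ q = 3 := by
    have := hq.two_le
    omega
  · exact sq_mul_sq_sub_one_ne ha hb hN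
  · by_cases ha5 : 5 ≤ a
    · exact cube_mul_cube_sub_one_ne ha5 hb hN2
    intro h
    have hpow : a ^ 3 * (a ^ N) ^ 3 = (a ^ 3) ^ (N + 1) := by ring
    rw [hpow] at h
    obtain rfl | rfl | rfl : a = 2 ∨ a = 3 ∨ a = 4 := by omega
    · exact eight_pow_sub_one_ne (n := N + 1) (by omega) b (by norm_num at h ⊢; exact h)
    · exact twentySeven_pow_sub_one_ne (n := N + 1) (by omega) b (by norm_num at h ⊢; exact h)
    · exact sixtyFour_pow_sub_one_ne (n := N + 1) (by omega) b (by norm_num at h ⊢; exact h)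

theorem stmt_12 (A : ℤ) (m : ℕ) (hA : 1 < A) (hm : 2 < m) :
    ¬∃ (y : ℤ) (q : ℕ), 1 < y ∧ 2 ≤ q ∧
      ((A ^ (m - 1) - 1) / (A - 1)) * A = y ^ q := by
  rintro ⟨y, q, -, hq, h⟩
  obtain ⟨N, rfl⟩ : ∃ N, m = N + 2 := ⟨m - 2, by omega⟩
  rw [show N + 2 - 1 = N + 1 by omega] at h
  have hgeom := geom_sum_mul A (N + 1)
  rw [← hgeom, Int.mul_ediv_cancel _ (by omega)] at h
  set S := ∑ i ∈ range (N + 1), A ^ i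
  have hS : 0 < S := sum_pos (fun i _ => pow_pos (by omega) i) ⟨0, by simp⟩
  have hcop : IsCoprime S A := by
    have : S = A * ∑ i ∈ range N, A ^ i + 1 := geom_sum_succ
    rw [this]
    exact ⟨1, -∑ i ∈ range N, A ^ i, by ring⟩
  obtain ⟨p, hp, r, rfl⟩ := Nat.exists_prime_and_dvd (by omega : q ≠ 1)
  rw [mul_comm p, pow_mul] at h
  obtain ⟨b, hb, hSb⟩ := Int.exists_pos_eq_pow_of_mul_eq_pow hp.ne_zero hS hcop h
  rw [mul_comm] at h
  obtain ⟨a, ha, hAa⟩ := Int.exists_pos_eq_pow_of_mul_eq_pow hp.ne_zero (by omega) hcop.symm h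
  have ha2 : 2 ≤ a := by
    by_contra! hlt
    obtain rfl : a = 1 := by omega
    rw [one_pow] at hAa
    omega
  refine pow_mul_pow_sub_one_ne hp ha2 hb (by omega : 1 ≤ N) ?_
  rw [← hAa, ← hSb, mul_comm (A - 1), hgeom, hAa]
  ring
end

section
/- There are infinitely many tuples of integers (a,b,c,r,s) with a>1, b>1, c>0, r>0, s>0 such that the equation r·a^x − s·b^y = c has exactly three solutions (x,y) in nonnegative integers, where moreover neither a nor b is a perfect power (the solutions are not redundant), a does not divide r and b does not divide s (the solutions are not improper), and the set of solutions is not reducible, i.e., writing (x₁,y₁) for the least solution, there is no integer k>1 for which r·a^(x₁)/k = r₁·a^w and s·b^(y₁)/k = s₁·b^z for some positive integers r₁, s₁ and nonnegative integers w, z. -/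
/-- An integer divisible by a prime `p` but not by `p ^ 2` is not a perfect power. -/
theorem not_isPerfectPower_of_prime_dvd {p N : ℤ} (hp : Prime p) (h1 : p ∣ N)
    (h2 : ¬p ^ 2 ∣ N) : ¬IsPerfectPower N := by
  rintro ⟨t, k, -, hk, rfl⟩
  exact h2 ((pow_dvd_pow p hk).trans (pow_dvd_pow_of_dvd (hp.dvd_of_dvd_pow h1) k))

/-- The solutions of `(a² + a - 1) aˣ - (a - 1) (a² + a)ʸ = a²` are `(0, 0)`, `(1, 1)`
and `(3, 2)`. -/
theorem sub_eq_sq_iff {a : ℤ} (ha : 1 < a) (x y : ℕ) :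
    (a ^ 2 + a - 1) * a ^ x - (a - 1) * (a ^ 2 + a) ^ y = a ^ 2 ↔
      (x = 0 ∧ y = 0) ∨ (x = 1 ∧ y = 1) ∨ (x = 3 ∧ y = 2) := by
  constructor
  · intro h
    have hr : 0 < a ^ 2 + a - 1 := by nlinarith
    have exponent_unique (n : ℕ) (hn : (a ^ 2 + a - 1) * a ^ x = (a ^ 2 + a - 1) * a ^ n) :
        x = n :=
      pow_right_injective₀ (by linarith) ha.ne' (mul_left_cancel₀ hr.ne' hn)
    rcases lt_or_ge y 3 with hy | hy
    · interval_cases y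
      · exact .inl ⟨exponent_unique 0 (by linear_combination h), rfl⟩
      · exact .inr (.inl ⟨exponent_unique 1 (by linear_combination h), rfl⟩)
      · exact .inr (.inr ⟨exponent_unique 3 (by linear_combination h), rfl⟩)
    · exfalso
      rcases lt_or_ge x 3 with hx | hx
      · have hax : a ^ x ≤ a ^ 2 := pow_le_pow_right₀ ha.le (by lia)
        have hby : (a ^ 2 + a) ^ 3 ≤ (a ^ 2 + a) ^ y := pow_le_pow_right₀ (by nlinarith) hy
        have hlt : (a ^ 2 + a - 1) * a ^ 2 < (a ^ 2 + a) ^ 3 :=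
          calc (a ^ 2 + a - 1) * a ^ 2 < (a ^ 2 + a) * (a ^ 2 + a) := by nlinarith
            _ ≤ (a ^ 2 + a) ^ 3 := by
              rw [← sq]
              exact pow_le_pow_right₀ (by nlinarith) (by norm_num)
        nlinarith [mul_le_mul_of_nonneg_left hax hr.le,
          mul_le_mul_of_nonneg_right (show 1 ≤ a - 1 by linarith)
            (show 0 ≤ (a ^ 2 + a) ^ y by positivity), sq_nonneg a]
      · have hb : a ^ 3 ∣ (a ^ 2 + a) ^ y :=
          (pow_dvd_pow a hy).trans (pow_dvd_pow_of_dvd ⟨a + 1, by ring⟩ y)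
        have hdvd : a ^ 3 ∣ a ^ 2 :=
          h ▸ dvd_sub ((pow_dvd_pow a hx).mul_left _) (hb.mul_left _)
        exact absurd (Int.le_of_dvd (by positivity) hdvd)
          (not_le.mpr (pow_lt_pow_right₀ ha (by norm_num)))
  · rintro (⟨rfl, rfl⟩ | ⟨rfl, rfl⟩ | ⟨rfl, rfl⟩) <;> ring

theorem stmt_13 :
    {t : ℤ × ℤ × ℤ × ℤ × ℤ |
      ∃ a b c r s : ℤ, t = (a, b, c, r, s) ∧
        1 < a ∧ 1 < b ∧ 0 < c ∧ 0 < r ∧ 0 < s ∧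
        -- exactly three solutions in nonnegative integers
        {p : ℕ × ℕ | r * a ^ p.1 - s * b ^ p.2 = c}.encard = 3 ∧
        -- not redundant
        ¬IsPerfectPower a ∧ ¬IsPerfectPower b ∧
        -- not improper
        ¬(a ∣ r) ∧ ¬(b ∣ s) ∧
        -- not reducible: the least solution (x₁, y₁) admits no common factor k > 1
        ∃ x₁ y₁ : ℕ, r * a ^ x₁ - s * b ^ y₁ = c ∧
          (∀ x y : ℕ, r * a ^ x - s * b ^ y = c → x₁ ≤ x) ∧
          ¬∃ k : ℤ, 1 < k ∧ ∃ (r₁ s₁ : ℤ) (w z : ℕ), 0 < r₁ ∧ 0 < s₁ ∧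
            r * a ^ x₁ = k * (r₁ * a ^ w) ∧
            s * b ^ y₁ = k * (s₁ * b ^ z)}.Infinite := by
  have hinj : Function.Injective fun p : {p : ℕ // p.Prime} ↦
      ((p : ℤ), (p : ℤ) ^ 2 + p, (p : ℤ) ^ 2, (p : ℤ) ^ 2 + p - 1, (p : ℤ) - 1) := by
    intro p q h
    exact Subtype.ext (Int.ofNat_inj.mp (congrArg Prod.fst h))
  have : Infinite {p : ℕ // p.Prime} := Nat.infinite_setOfPred_prime.to_subtype
  refine (Set.infinite_range_of_injective hinj).mono ?_
  rintro _ ⟨⟨p, hp⟩, rfl⟩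
  have hprime : Prime (p : ℤ) := Nat.prime_iff_prime_int.mp hp
  have ha : (1 : ℤ) < p := by exact_mod_cast hp.one_lt
  have not_dvd_one : ¬(p : ℤ) ∣ 1 := hprime.not_dvd_one
  dsimp only
  generalize (p : ℤ) = a at *
  refine ⟨a, a ^ 2 + a, a ^ 2, a ^ 2 + a - 1, a - 1, rfl, ha, by nlinarith, by positivity,
    by nlinarith, by linarith, ?_, ?_, ?_, ?_, ?_, 0, 0, by ring, fun _ _ _ ↦ Nat.zero_le _, ?_⟩
  · have hset : {q : ℕ × ℕ | (a ^ 2 + a - 1) * a ^ q.1 - (a - 1) * (a ^ 2 + a) ^ q.2 = a ^ 2} =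
        {(0, 0), (1, 1), (3, 2)} := by
      ext ⟨x, y⟩
      simp [sub_eq_sq_iff ha]
    rw [hset, Set.encard_eq_three]
    exact ⟨_, _, _, by simp, by simp, by simp, rfl⟩
  · refine not_isPerfectPower_of_prime_dvd hprime dvd_rfl ?_
    rintro ⟨m, hm⟩
    exact not_dvd_one ⟨m, mul_left_cancel₀ hprime.ne_zero (by linear_combination hm)⟩
  · refine not_isPerfectPower_of_prime_dvd hprime ⟨a + 1, by ring⟩ ?_
    rintro ⟨m, hm⟩
    exact not_dvd_one ⟨m - 1, mul_left_cancel₀ hprime.ne_zero (by linear_combination hm)⟩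
  · rintro ⟨m, hm⟩
    exact not_dvd_one ⟨a + 1 - m, by linear_combination -hm⟩
  · intro h
    nlinarith [Int.le_of_dvd (by linarith) h]
  · rintro ⟨k, hk, r₁, s₁, w, z, -, -, hr, hs⟩
    have hk1 : k ∣ 1 :=
      ⟨r₁ * a ^ w - (a + 2) * (s₁ * (a ^ 2 + a) ^ z), by
        linear_combination hr - (a + 2) * hs⟩
    exact hk.not_ge (Int.le_of_dvd one_pos hk1)
end
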